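/- arXiv:1203.4107 — 5 statements merged into one kernel-verified Lean document; each statement's English description precedes it below -/
import Mathlib

section
/- Let n = pq where p and q are distinct odd primes. Then every Reinhardt polynomial F for n is periodic; in fact, F is p-antiperiodic or q-antiperiodic. (Equivalently, there are no sporadic Reinhardt polygons with n = pq sides.) -/
open Polynomial

/-- The nonzero coefficients of `F`, read in order of increasing degree, alternate in sign:
any two nonzero coefficients with only zero coefficients strictly between them have
opposite signs. -/
def AltSigns (F : Polynomial ℤ) : Prop :=
  ∀ i j : ℕ, i < j → F.coeff i ≠ 0 → F.coeff j ≠ 0 →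
    (∀ k, i < k → k < j → F.coeff k = 0) → F.coeff j = -F.coeff i

/-- `F` is a Reinhardt polynomial for `n`: `F(0) = 1`, `deg F < n`, every coefficient lies
in `{-1, 0, 1}`, the nonzero coefficients read in order of increasing degree alternate in
sign beginning and ending with `+1` (so their number is odd), and `Φ_{2n} ∣ F`. -/
def IsReinhardt (n : ℕ) (F : Polynomial ℤ) : Prop :=
  F.coeff 0 = 1 ∧
  F.degree < (n : WithBot ℕ) ∧
  (∀ k, F.coeff k ∈ ({-1, 0, 1} : Set ℤ)) ∧
  AltSigns F ∧
  (∀ i, F.coeff i ≠ 0 → (∀ k, k < i → F.coeff k = 0) → F.coeff i = 1) ∧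
  (∀ i, F.coeff i ≠ 0 → (∀ k, i < k → F.coeff k = 0) → F.coeff i = 1) ∧
  Odd F.support.card ∧
  cyclotomic (2 * n) ℤ ∣ F

/-- The doubled coefficient sequence `u_F : ℤ/2nℤ → ℤ`: `u_F(k)` is the coefficient of
`z^k` in `F` for `0 ≤ k < n`, and `u_F(n + k) = -u_F(k)` for `0 ≤ k < n`. -/
def uF (n : ℕ) (F : Polynomial ℤ) (k : ZMod (2 * n)) : ℤ :=
  if k.val < n then F.coeff k.val else -F.coeff (k.val - n)

/-- `F` is `m`-antiperiodic: `u_F(k + m) = -u_F(k)` for all `k ∈ ℤ/2nℤ`. -/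
def Antiper (n : ℕ) (F : Polynomial ℤ) (m : ℕ) : Prop :=
  ∀ k : ZMod (2 * n), uF n F (k + (m : ZMod (2 * n))) = -uF n F k

/-- `F` is periodic: it is `(n/d)`-antiperiodic for some odd divisor `d > 1` of `n`. -/
def IsPeriodicR (n : ℕ) (F : Polynomial ℤ) : Prop :=
  ∃ d : ℕ, d ∣ n ∧ Odd d ∧ 1 < d ∧ Antiper n F (n / d)

/-- A `{0, 1}`-valued sequence whose mixed second difference with steps `2p` and `2q` vanishes
is `2p`-periodic or `2q`-periodic on the even numbers, for coprime `p` and `q`. -/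
lemma even_periodic_or_of_mixed_difference_eq_zero {p q : ℕ} (hpq : p.Coprime q) {S : ℕ → ℤ}
    (hS : ∀ k, S k = 0 ∨ S k = 1)
    (hmix : ∀ k, S (k + 2 * p + 2 * q) + S k = S (k + 2 * p) + S (k + 2 * q)) :
    (∀ k, S (2 * k + 2 * p) = S (2 * k)) ∨ (∀ k, S (2 * k + 2 * q) = S (2 * k)) := by
  by_contra! h
  obtain ⟨⟨k, hk⟩, l, hl⟩ := h
  obtain ⟨m, hmk, hml⟩ := Nat.chineseRemainder hpq.symm k l
  have hG : ∀ i j, S (2 * (i + q * j) + 2 * p) - S (2 * (i + q * j))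
      = S (2 * i + 2 * p) - S (2 * i) := by
    intro i j
    induction j with
    | zero => simp
    | succ j ih =>
      have := hmix (2 * (i + q * j))
      rw [show 2 * (i + q * (j + 1)) + 2 * p = 2 * (i + q * j) + 2 * p + 2 * q by ring,
        show 2 * (i + q * (j + 1)) = 2 * (i + q * j) + 2 * q by ring]
      linarith
  have hH : ∀ i j, S (2 * (i + p * j) + 2 * q) - S (2 * (i + p * j))
      = S (2 * i + 2 * q) - S (2 * i) := by
    intro i j
    induction j with
    | zero => simp
    | succ j ih =>
      have := hmix (2 * (i + p * j))
      rw [show 2 * (i + p * (j + 1)) + 2 * q = 2 * (i + p * j) + 2 * p + 2 * q by ring,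
        show 2 * (i + p * (j + 1)) = 2 * (i + p * j) + 2 * p by ring]
      linarith
  have hGmod : ∀ i, S (2 * i + 2 * p) - S (2 * i)
      = S (2 * (i % q) + 2 * p) - S (2 * (i % q)) := fun i => by
    conv_lhs => rw [← Nat.mod_add_div i q]
    exact hG _ _
  have hHmod : ∀ i, S (2 * i + 2 * q) - S (2 * i)
      = S (2 * (i % p) + 2 * q) - S (2 * (i % p)) := fun i => by
    conv_lhs => rw [← Nat.mod_add_div i p]
    exact hH _ _
  have h1 := hGmod m
  rw [hmk, ← hGmod k] at h1
  have h2 := hHmod m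
  rw [hml, ← hHmod l] at h2
  have h3 := hmix (2 * m)
  have := hS (2 * m)
  have := hS (2 * m + 2 * p)
  have := hS (2 * m + 2 * q)
  have := hS (2 * m + 2 * p + 2 * q)
  omega

/-- An `n`-antiperiodic sequence, `n = pq` odd, whose sums of adjacent terms at even positions
are `2p`-periodic, is `p`-antiperiodic. -/
lemma antiperiodic_of_even_periodic {p q : ℕ} (hop : Odd p) (hoq : Odd q) {U : ℕ → ℤ}
    (hU : ∀ k, U (k + p * q) = -U k)
    (hW : ∀ k, U (2 * k + 2 * p) + U (2 * k + 2 * p + 1) = U (2 * k) + U (2 * k + 1)) (k : ℕ) :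
    U (k + p) = -U k := by
  have hW' : ∀ k, U (k + 2 * p) + U (k + 2 * p + 1) = U k + U (k + 1) := by
    intro k
    rcases Nat.even_or_odd' k with ⟨m, rfl | rfl⟩
    · exact hW m
    · obtain ⟨s, hs⟩ := hop.mul hoq
      have := hW (m + s + 1)
      have h1 := hU (2 * m + 1)
      have h2 := hU (2 * m + 1 + 1)
      have h3 := hU (2 * m + 1 + 2 * p)
      have h4 := hU (2 * m + 1 + 2 * p + 1)
      rw [hs] at h1 h2 h3 h4
      ring_nf at *
      linarith
  have hWmul : ∀ j k, U (k + p * (2 * j)) + U (k + p * (2 * j) + 1) = U k + U (k + 1) := by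
    intro j k
    induction j with
    | zero => simp
    | succ j ih =>
      have := hW' (k + p * (2 * j))
      rw [show k + p * (2 * (j + 1)) = k + p * (2 * j) + 2 * p by ring]
      linarith
  obtain ⟨t, ht⟩ := id hoq
  have hV : ∀ k, U (k + 1) + U (k + 1 + p) = -(U k + U (k + p)) := by
    intro k
    have h := hWmul t (k + p)
    have h1 := hU k
    have h2 := hU (k + 1)
    rw [ht] at h1 h2
    ring_nf at *
    linarith
  have hVpow : ∀ j, U (k + j) + U (k + j + p) = (-1) ^ j * (U k + U (k + p)) := by
    intro j
    induction j with
    | zero => simp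
    | succ j ih =>
      rw [← add_assoc, hV, ih]
      ring
  have hmul : ∀ i : ℕ, (-1) ^ i * U (k + p * i) = U k - i * (U k + U (k + p)) := by
    intro i
    induction i with
    | zero => simp
    | succ i ih =>
      have h := hVpow (p * i)
      rw [pow_mul, hop.neg_one_pow] at h
      have h2 : ((-1 : ℤ) ^ i) * (-1) ^ i = 1 := by rw [← mul_pow]; simp
      rw [show k + p * (i + 1) = k + p * i + p by ring]
      push_cast
      rw [pow_succ]
      linear_combination ih - (-1) ^ i * h - (U k + U (k + p)) * h2
  have h := hmul q
  rw [hU, hoq.neg_one_pow] at h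
  have hq0 : (q : ℤ) ≠ 0 := by have := hoq.pos; omega
  have : (q : ℤ) * (U k + U (k + p)) = 0 := by linarith
  have := (mul_eq_zero.mp this).resolve_left hq0
  linarith

lemma cyclotomic_two_mul_mul_mul_eq {p q : ℕ} (hp : p.Prime) (hq : q.Prime) (hop : Odd p)
    (hoq : Odd q) (hpq : p ≠ q) :
    (X ^ p + 1) * (X ^ q + 1) * cyclotomic (2 * (p * q)) ℤ = (X + 1) * (X ^ (p * q) + 1) := by
  have hp2 : ¬ p ∣ 2 := fun h => by
    have := (Nat.prime_dvd_prime_iff_eq hp Nat.prime_two).mp h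
    subst this; exact absurd hop (by decide)
  have hq2 : ¬ q ∣ 2 := fun h => by
    have := (Nat.prime_dvd_prime_iff_eq hq Nat.prime_two).mp h
    subst this; exact absurd hoq (by decide)
  have hq2p : ¬ q ∣ 2 * p := fun h => by
    rcases hq.dvd_mul.mp h with h | h
    · exact hq2 h
    · exact hpq ((Nat.prime_dvd_prime_iff_eq hq hp).mp h).symm
  have h1 := cyclotomic_expand_eq_cyclotomic_mul hp hp2 ℤ
  have h2 := cyclotomic_expand_eq_cyclotomic_mul hq hq2 ℤ
  have h3 := cyclotomic_expand_eq_cyclotomic_mul hq hq2p ℤ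
  have h4 := congrArg (expand ℤ q) h1
  rw [map_mul, h3, h2] at h4
  rw [h2.symm.trans (by simp : expand ℤ q (cyclotomic 2 ℤ) = X ^ q + 1)] at h4
  simp only [cyclotomic_two, map_add, expand_X, map_one, map_pow, ← pow_mul] at h1 h4
  rw [← mul_assoc 2 p q, mul_comm p q, h4, h1]
  ring

lemma uF_natCast (n : ℕ) (F : Polynomial ℤ) (k : ℕ) :
    uF n F (k : ZMod (2 * n)) =
      if k % (2 * n) < n then F.coeff (k % (2 * n)) else -F.coeff (k % (2 * n) - n) := by
  simp [uF, ZMod.val_natCast]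

lemma uF_natCast_of_lt {n : ℕ} (F : Polynomial ℤ) {k : ℕ} (hk : k < n) :
    uF n F (k : ZMod (2 * n)) = F.coeff k := by
  rw [uF_natCast, Nat.mod_eq_of_lt (by omega), if_pos hk]

lemma uF_natCast_add {n : ℕ} (hn : 0 < n) (F : Polynomial ℤ) (k : ℕ) :
    uF n F ((k + n : ℕ) : ZMod (2 * n)) = -uF n F (k : ZMod (2 * n)) := by
  rw [uF_natCast, uF_natCast, Nat.add_mod, Nat.mod_eq_of_lt (show n < 2 * n by omega)]
  have hr := Nat.mod_lt k (show 0 < 2 * n by omega)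
  generalize k % (2 * n) = r at hr ⊢
  by_cases h : r < n
  · rw [Nat.mod_eq_of_lt (by omega), if_neg (by omega), if_pos h, Nat.add_sub_cancel]
  · rw [Nat.mod_eq_sub_mod (by omega), Nat.mod_eq_of_lt (by omega), if_pos (by omega), if_neg h,
      neg_neg]
    congr 1
    omega

lemma antiper_of_natCast {n : ℕ} (hn : 0 < n) {F : Polynomial ℤ} {m : ℕ}
    (h : ∀ k : ℕ, uF n F ((k + m : ℕ) : ZMod (2 * n)) = -uF n F (k : ZMod (2 * n))) :
    Antiper n F m := by
  intro k
  have : NeZero (2 * n) := ⟨by omega⟩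
  simpa using h k.val

/-- The doubled sequence has generating series `F / (1 + X ^ n)`. -/
lemma mk_uF_mul {n : ℕ} (hn : 0 < n) {F : Polynomial ℤ} (hF : F.degree < n) :
    PowerSeries.mk (fun k => uF n F (k : ZMod (2 * n))) * (PowerSeries.X ^ n + 1)
      = (F : PowerSeries ℤ) := by
  ext k
  rw [mul_add, mul_one, map_add, PowerSeries.coeff_mul_X_pow', PowerSeries.coeff_mk,
    Polynomial.coeff_coe]
  by_cases h : n ≤ k
  · obtain ⟨m, rfl⟩ := Nat.exists_eq_add_of_le' h
    rw [if_pos h, Nat.add_sub_cancel, PowerSeries.coeff_mk, uF_natCast_add hn,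
      coeff_eq_zero_of_degree_lt (hF.trans_le (by exact_mod_cast h))]
    ring
  · rw [if_neg h, PowerSeries.coeff_mk, uF_natCast_of_lt F (by omega), zero_add]

lemma uF_four_term {p q : ℕ} (hp : p.Prime) (hq : q.Prime) (hop : Odd p) (hoq : Odd q)
    (hpq : p ≠ q) {F : Polynomial ℤ} (hdeg : F.degree < ((p * q : ℕ) : WithBot ℕ))
    (hF : cyclotomic (2 * (p * q)) ℤ ∣ F) {u : ℕ → ℤ}
    (hu : ∀ k, u k = uF (p * q) F (k : ZMod (2 * (p * q)))) (k : ℕ) :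
    u (k + p + q) + u (k + p) + u (k + q) + u k = 0 := by
  have hn : 0 < p * q := Nat.mul_pos hp.pos hq.pos
  obtain ⟨G, hG⟩ := hF
  set H : Polynomial ℤ := (X + 1) * G with hH
  have hHeq : (X ^ p + 1) * (X ^ q + 1) * F = H * (X ^ (p * q) + 1) := by
    rw [hG, ← mul_assoc, cyclotomic_two_mul_mul_mul_eq hp hq hop hoq hpq]
    ring
  have hseries := mk_uF_mul hn hdeg
  rw [show (fun k : ℕ => uF (p * q) F (k : ZMod (2 * (p * q)))) = u from
    funext fun k => (hu k).symm] at hseries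
  have hser : (PowerSeries.X ^ p + 1) * (PowerSeries.X ^ q + 1) * PowerSeries.mk u
      = (H : PowerSeries ℤ) := by
    have h := congrArg (fun P : Polynomial ℤ => (P : PowerSeries ℤ)) hHeq
    simp only [Polynomial.coe_mul, Polynomial.coe_add, Polynomial.coe_pow, Polynomial.coe_X,
      Polynomial.coe_one, ← hseries] at h
    rw [← mul_assoc] at h
    refine mul_right_cancel₀ (fun h0 => ?_) h
    have := congrArg (PowerSeries.coeff 0) h0
    simp [hp.ne_zero, hq.ne_zero] at this
  have hHdeg : H.degree < ((p + q : ℕ) : WithBot ℕ) := by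
    have hmon : ∀ m : ℕ, 0 < m → (X ^ m + 1 : Polynomial ℤ).degree = (m : WithBot ℕ) :=
      fun m hm => by simpa using degree_X_pow_add_C (R := ℤ) hm 1
    have h := congrArg degree hHeq
    rw [degree_mul, degree_mul, degree_mul, hmon p hp.pos, hmon q hq.pos, hmon _ hn] at h
    by_contra! hcon
    have hF0 : F ≠ 0 := by
      rintro rfl
      have h0 : H = 0 := by
        rcases mul_eq_zero.mp (hHeq.symm.trans (mul_zero _)) with h0 | h0
        · exact h0
        · have := hmon _ hn
          rw [h0, degree_zero] at this
          exact absurd this (WithBot.bot_ne_coe)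
      rw [h0] at hcon
      simp at hcon
    have hH0 : H ≠ 0 := by
      intro h0
      rw [h0] at hcon
      simp at hcon
    rw [degree_eq_natDegree hF0] at hdeg h
    rw [degree_eq_natDegree hH0] at hcon h
    norm_cast at hdeg hcon h
    omega
  have hc := congrArg (PowerSeries.coeff (k + p + q)) hser
  rw [Polynomial.coeff_coe, coeff_eq_zero_of_degree_lt
      (hHdeg.trans_le (by exact_mod_cast (by omega : p + q ≤ k + p + q))),
    show (PowerSeries.X ^ p + 1) * (PowerSeries.X ^ q + 1) * PowerSeries.mk u
      = PowerSeries.mk u * PowerSeries.X ^ (p + q) + PowerSeries.mk u * PowerSeries.X ^ p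
        + PowerSeries.mk u * PowerSeries.X ^ q + PowerSeries.mk u by ring] at hc
  simp only [map_add, PowerSeries.coeff_mul_X_pow', PowerSeries.coeff_mk] at hc
  rw [if_pos (by omega), if_pos (by omega), if_pos (by omega),
    show k + p + q - (p + q) = k by omega, show k + p + q - p = k + q by omega,
    show k + p + q - q = k + p by omega] at hc
  linarith

/-- The partial sums of the coefficients of an alternating polynomial are governed by the last
nonzero coefficient read. -/
lemma AltSigns.sum_range {F : Polynomial ℤ} (hF : AltSigns F) (h0 : F.coeff 0 = 1) (k : ℕ) :
    ∃ i ≤ k, (∀ j, i < j → j ≤ k → F.coeff j = 0) ∧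
      (F.coeff i = 1 ∧ ∑ j ∈ Finset.range (k + 1), F.coeff j = 1 ∨
        F.coeff i = -1 ∧ ∑ j ∈ Finset.range (k + 1), F.coeff j = 0) := by
  induction k with
  | zero => exact ⟨0, le_rfl, fun j h1 h2 => by omega, Or.inl ⟨h0, by simpa using h0⟩⟩
  | succ k ih =>
    obtain ⟨i, hik, hz, hi⟩ := ih
    rw [Finset.sum_range_succ]
    by_cases hk : F.coeff (k + 1) = 0
    · refine ⟨i, by omega, fun j h1 h2 => ?_, by simpa [hk] using hi⟩
      rcases Nat.lt_or_ge k j with h | h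
      · rwa [show j = k + 1 by omega]
      · exact hz j h1 h
    · have hne : F.coeff i ≠ 0 := by rcases hi with h | h <;> rw [h.1] <;> decide
      have := hF i (k + 1) (by omega) hne hk fun j h1 h2 => hz j h1 (by omega)
      refine ⟨k + 1, le_rfl, fun j h1 h2 => by omega, ?_⟩
      rcases hi with h | h
      · right; constructor <;> linarith
      · left; constructor <;> linarith

lemma IsReinhardt.sum_range_uF {n : ℕ} (hn : 0 < n) {F : Polynomial ℤ} (hF : IsReinhardt n F)
    (k : ℕ) : ∑ j ∈ Finset.range k, uF n F (j : ZMod (2 * n)) = 0 ∨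
      ∑ j ∈ Finset.range k, uF n F (j : ZMod (2 * n)) = 1 := by
  obtain ⟨h0, hdeg, -, halt, -, hlast, -⟩ := hF
  have hle : ∀ k ≤ n, ∑ j ∈ Finset.range k, uF n F (j : ZMod (2 * n))
      = ∑ j ∈ Finset.range k, F.coeff j := fun k hk =>
    Finset.sum_congr rfl fun j hj => uF_natCast_of_lt F
      ((Finset.mem_range.mp hj).trans_le hk)
  have hsum : ∑ j ∈ Finset.range n, uF n F (j : ZMod (2 * n)) = 1 := by
    rw [hle n le_rfl]
    obtain ⟨m, rfl⟩ := Nat.exists_eq_succ_of_ne_zero hn.ne'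
    obtain ⟨i, him, hz, hi⟩ := halt.sum_range h0 m
    have hne : F.coeff i ≠ 0 := by rcases hi with h | h <;> rw [h.1] <;> decide
    have h1 := hlast i hne fun j hj => by
      rcases Nat.lt_or_ge m j with h | h
      · exact coeff_eq_zero_of_degree_lt (hdeg.trans_le (by exact_mod_cast h))
      · exact hz j hj h
    rcases hi with h | h
    · exact h.2
    · rw [h1] at h; exact absurd h.1 (by decide)
  induction k using Nat.strong_induction_on with
  | _ k ih =>
    by_cases hk : k ≤ n
    · rw [hle k hk]
      cases k with
      | zero => simp
      | succ m =>
        obtain ⟨i, -, -, h | h⟩ := halt.sum_range h0 m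
        · exact Or.inr h.2
        · exact Or.inl h.2
    · obtain ⟨m, rfl⟩ := Nat.exists_eq_add_of_le (le_of_not_ge hk)
      rw [Finset.sum_range_add, hsum]
      simp only [add_comm n, uF_natCast_add hn, Finset.sum_neg_distrib]
      rcases ih m (by omega) with h | h <;> rw [h] <;> simp

/-- If `n = pq` with `p` and `q` distinct odd primes, then every Reinhardt
polynomial `F` for `n` is periodic; in fact, `F` is `p`-antiperiodic or `q`-antiperiodic. -/
theorem no_sporadic_pq (p q : ℕ) (hp : p.Prime) (hq : q.Prime) (hop : Odd p) (hoq : Odd q)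
    (hpq : p ≠ q) (F : Polynomial ℤ) (hF : IsReinhardt (p * q) F) :
    IsPeriodicR (p * q) F ∧ (Antiper (p * q) F p ∨ Antiper (p * q) F q) := by
  have hn : 0 < p * q := Nat.mul_pos hp.pos hq.pos
  set u : ℕ → ℤ := fun k => uF (p * q) F (k : ZMod (2 * (p * q))) with hu
  have hanti : ∀ k, u (k + p * q) = -u k := fun k => uF_natCast_add hn F k
  have hfour : ∀ k, u (k + p + q) + u (k + p) + u (k + q) + u k = 0 :=
    uF_four_term hp hq hop hoq hpq hF.2.1 hF.2.2.2.2.2.2.2 fun _ => rfl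
  set S : ℕ → ℤ := fun k => ∑ j ∈ Finset.range k, u j with hS
  have hS01 : ∀ k, S k = 0 ∨ S k = 1 := fun k => hF.sum_range_uF hn k
  have hSsucc : ∀ k, S (k + 1) = S k + u k := fun k => Finset.sum_range_succ _ _
  have hSfour : ∀ k, S (k + p + q) + S (k + p) + S (k + q) + S k = S (p + q) + S p + S q := by
    intro k
    induction k with
    | zero => simp [hS]
    | succ k ih =>
      have := hfour k
      have h1 := hSsucc (k + p + q)
      have h2 := hSsucc (k + p)
      have h3 := hSsucc (k + q)
      have h4 := hSsucc k
      rw [show k + 1 + p + q = k + p + q + 1 by ring, show k + 1 + p = k + p + 1 by ring,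
        show k + 1 + q = k + q + 1 by ring]
      linarith
  have hmix : ∀ k, S (k + 2 * p + 2 * q) + S k = S (k + 2 * p) + S (k + 2 * q) := by
    intro k
    have h1 := hSfour k
    have h2 := hSfour (k + p)
    have h3 := hSfour (k + q)
    have h4 := hSfour (k + p + q)
    ring_nf at *
    linarith
  have hadj : ∀ m, (∀ k, S (2 * k + 2 * m) = S (2 * k)) → ∀ k,
      u (2 * k + 2 * m) + u (2 * k + 2 * m + 1) = u (2 * k) + u (2 * k + 1) := by
    intro m hm k
    have h1 := hm k
    have h2 := hm (k + 1)
    rw [show 2 * (k + 1) + 2 * m = 2 * k + 2 * m + 1 + 1 by ring,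
      show 2 * (k + 1) = 2 * k + 1 + 1 by ring] at h2
    simp only [hSsucc] at h2
    linarith
  rcases even_periodic_or_of_mixed_difference_eq_zero ((Nat.coprime_primes hp hq).mpr hpq)
    hS01 hmix with h | h
  · have hA : Antiper (p * q) F p :=
      antiper_of_natCast hn (antiperiodic_of_even_periodic hop hoq hanti (hadj p h))
    refine ⟨⟨q, dvd_mul_left q p, hoq, hq.one_lt, ?_⟩, Or.inl hA⟩
    rwa [Nat.mul_div_cancel _ hq.pos]
  · have hA : Antiper (p * q) F q :=
      antiper_of_natCast hn (antiperiodic_of_even_periodic hoq hop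
        (fun k => by rw [mul_comm]; exact hanti k) (hadj q h))
    refine ⟨⟨p, dvd_mul_right p q, hop, hp.one_lt, ?_⟩, Or.inr hA⟩
    rwa [Nat.mul_div_cancel_left _ hp.pos]
end

section
/- Let n = pq where p and q are distinct odd primes. If F is a Reinhardt polynomial for n, then either Φ_p(−z^q) divides F(z) or Φ_q(−z^p) divides F(z) in ℤ[z]. -/
open Polynomial

/-- `Φ_{2pq}` divides `X ^ (p * q) + 1`, which divides `(X ^ p + 1) * (X ^ q + 1) * Φ_{2pq}`. -/
theorem cyclotomic_dvd_X_pow_mul_add_one_dvd {p q : ℕ} (hp : p.Prime) (hq : q.Prime)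
    (hop : Odd p) (hoq : Odd q) (hpq : p ≠ q) :
    cyclotomic (2 * (p * q)) ℤ ∣ X ^ (p * q) + 1 ∧
      (X ^ (p * q) + 1 : ℤ[X]) ∣ (X ^ p + 1) * (X ^ q + 1) * cyclotomic (2 * (p * q)) ℤ := by
  have expand_two : ∀ r : ℕ, r.Prime → Odd r →
      (X ^ r + 1 : ℤ[X]) = cyclotomic (2 * r) ℤ * cyclotomic 2 ℤ := by
    intro r hr hor
    have hr2 : ¬ r ∣ 2 := fun h => by
      rcases (Nat.dvd_prime Nat.prime_two).1 h with rfl | rfl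
      · exact Nat.not_prime_one hr
      · exact absurd hor (by decide)
    rw [← cyclotomic_expand_eq_cyclotomic_mul hr hr2 ℤ, cyclotomic_two]
    simp
  have hq2p : ¬ q ∣ 2 * p := fun h => by
    rcases hq.dvd_mul.1 h with h | h
    · rcases (Nat.dvd_prime Nat.prime_two).1 h with rfl | rfl
      · exact Nat.not_prime_one hq
      · exact absurd hoq (by decide)
    · exact hpq ((Nat.prime_dvd_prime_iff_eq hq hp).1 h).symm
  have hmul : (X ^ (p * q) + 1 : ℤ[X]) =
      (cyclotomic (2 * (p * q)) ℤ * cyclotomic (2 * p) ℤ) * (X ^ q + 1) := by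
    have h := congrArg (expand ℤ q) (expand_two p hp hop)
    rw [map_mul, cyclotomic_expand_eq_cyclotomic_mul hq hq2p ℤ, cyclotomic_two, mul_assoc] at h
    simpa [← pow_mul, mul_comm, mul_left_comm, mul_assoc] using h
  rw [hmul, expand_two p hp hop]
  exact ⟨⟨_, mul_assoc _ _ _⟩, cyclotomic 2 ℤ, by ring⟩

theorem X_pow_add_one_mul_cyclotomic_comp {p q : ℕ} (hq : q.Prime) (hoq : Odd q) :
    (X ^ p + 1 : ℤ[X]) * (cyclotomic q ℤ).comp (-(X ^ p)) = X ^ (p * q) + 1 := by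
  have : Fact q.Prime := ⟨hq⟩
  have h := congrArg (fun P : ℤ[X] => P.comp (-(X ^ p))) (cyclotomic_prime_mul_X_sub_one ℤ q)
  simp only [mul_comp, sub_comp, X_comp, one_comp, pow_comp, hoq.neg_pow, ← pow_mul] at h
  linear_combination -h

/-- The `n`-antiperiodic extension of the first `n` coefficients of `Q`. -/
def antiExt (n : ℕ) (Q : ℤ[X]) (k : ℕ) : ℤ := (-1) ^ (k / n) * Q.coeff (k % n)

theorem antiExt_add {n : ℕ} (hn : 0 < n) (Q : ℤ[X]) (k : ℕ) :
    antiExt n Q (k + n) = -antiExt n Q k := by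
  simp [antiExt, Nat.add_div_right _ hn, pow_succ]

/-- A sequence with antiperiod `m` is determined up to sign along residue classes mod `m`. -/
theorem ne_zero_of_antiperiodic {m : ℕ} {f : ℕ → ℤ} (hf : ∀ k, f (k + m) = -f k) {k : ℕ}
    (hk : f k ≠ 0) (j : ℕ) : f (k + j * m) ≠ 0 := by
  induction j with
  | zero => simpa using hk
  | succ j ih =>
    rw [Nat.succ_mul, ← add_assoc, hf]
    exact neg_ne_zero.2 ih

theorem one_add_X_pow_mul_antiExt {n : ℕ} (hn : 0 < n) {Q : ℤ[X]}
    (hQ : ∀ k, n ≤ k → Q.coeff k = 0) :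
    ((X ^ n + 1 : ℤ[X]) : PowerSeries ℤ) * PowerSeries.mk (antiExt n Q) = Q := by
  ext k
  simp only [coe_add, coe_pow, coe_X, coe_one, add_mul, one_mul, map_add,
    PowerSeries.coeff_X_pow_mul', PowerSeries.coeff_mk, coeff_coe]
  split_ifs with h
  · obtain ⟨j, rfl⟩ := Nat.exists_eq_add_of_le' h
    simp [antiExt_add hn, hQ _ h]
  · simp [antiExt, Nat.div_eq_of_lt (not_le.1 h), Nat.mod_eq_of_lt (not_le.1 h)]

theorem coe_X_pow_add_one_ne_zero {n : ℕ} (hn : 0 < n) :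
    ((X ^ n + 1 : ℤ[X]) : PowerSeries ℤ) ≠ 0 := by
  intro h
  have := congrArg (PowerSeries.coeff 0) h
  simp [hn.ne'] at this

theorem antiExt_relation {p q n : ℕ} (hn : 0 < n) {Q : ℤ[X]} (hQ : ∀ k, n ≤ k → Q.coeff k = 0)
    (h : (X ^ n + 1 : ℤ[X]) ∣ (X ^ p + 1) * (X ^ q + 1) * Q) (k : ℕ) :
    antiExt n Q (k + p + q) + antiExt n Q (k + p) + antiExt n Q (k + q) + antiExt n Q k = 0 := by
  obtain ⟨M, hM⟩ := h
  have hW : (((X ^ p + 1) * (X ^ q + 1) : ℤ[X]) : PowerSeries ℤ) *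
      PowerSeries.mk (antiExt n Q) = M := by
    apply mul_left_cancel₀ (coe_X_pow_add_one_ne_zero hn)
    rw [mul_left_comm, one_add_X_pow_mul_antiExt hn hQ, ← coe_mul, hM, coe_mul]
  have hlarge : ∀ k, M.natDegree < k →
      antiExt n Q (k + p + q) + antiExt n Q (k + p) + antiExt n Q (k + q) + antiExt n Q k = 0 := by
    intro k hk
    have h := congrArg (PowerSeries.coeff (k + p + q)) hW
    rw [coeff_coe, coeff_eq_zero_of_natDegree_lt (by omega)] at h
    have e : ((X ^ p + 1) * (X ^ q + 1) : ℤ[X]) = X ^ (p + q) + X ^ p + X ^ q + 1 := by ring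
    simp only [e, coe_add, coe_pow, coe_X, coe_one, add_mul, one_mul, map_add,
      PowerSeries.coeff_X_pow_mul', PowerSeries.coeff_mk] at h
    rw [if_pos (by omega), if_pos (by omega), if_pos (by omega),
      show k + p + q - (p + q) = k by omega, show k + p + q - p = k + q by omega,
      show k + p + q - q = k + p by omega] at h
    linarith
  by_contra hne
  refine ne_zero_of_antiperiodic (m := n) (f := fun k => antiExt n Q (k + p + q) +
    antiExt n Q (k + p) + antiExt n Q (k + q) + antiExt n Q k) (fun k => ?_) hne
    (M.natDegree + 1) (hlarge _ ?_)
  · simp only [add_right_comm k n, add_right_comm (k + p) n, antiExt_add hn]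
    ring
  · nlinarith

theorem dvd_of_antiExt_antiperiodic {p n : ℕ} (hn : 0 < n) {Q R : ℤ[X]}
    (hQ : ∀ k, n ≤ k → Q.coeff k = 0) (hR : (X ^ p + 1) * R = X ^ n + 1)
    (h : ∀ k, antiExt n Q (k + p) + antiExt n Q k = 0) : R ∣ Q := by
  set W := PowerSeries.mk (antiExt n Q) with hW
  have htrunc : ((X ^ p + 1 : ℤ[X]) : PowerSeries ℤ) * W = (PowerSeries.trunc p W : ℤ[X]) := by
    ext k
    simp only [coe_add, coe_pow, coe_X, coe_one, add_mul, one_mul, map_add,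
      PowerSeries.coeff_X_pow_mul', PowerSeries.coeff_mk, coeff_coe, PowerSeries.coeff_trunc, hW]
    split_ifs with h1 h2 h2
    · omega
    · obtain ⟨j, rfl⟩ := Nat.exists_eq_add_of_le' h1
      have := h j
      simp only [Nat.add_sub_cancel]
      linarith
    · simp
    · omega
  refine ⟨PowerSeries.trunc p W, ?_⟩
  apply coe_injective ℤ
  rw [← one_add_X_pow_mul_antiExt hn hQ, ← hR, coe_mul, coe_mul, ← htrunc]
  ring

/-- A polynomial of degree less than `pq` with coefficients `±1` which is divisible by `Φ_{2pq}`
is divisible by `Φ_p(-z^q)` or by `Φ_q(-z^p)`. -/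
theorem dvd_or_dvd_of_coeff_eq_one_or_neg_one {p q : ℕ} (hp : p.Prime) (hq : q.Prime)
    (hop : Odd p) (hoq : Odd q) (hpq : p ≠ q) {Q : ℤ[X]}
    (hdeg : ∀ k, p * q ≤ k → Q.coeff k = 0)
    (hcoeff : ∀ k, k < p * q → Q.coeff k = 1 ∨ Q.coeff k = -1)
    (hdvd : cyclotomic (2 * (p * q)) ℤ ∣ Q) :
    (cyclotomic p ℤ).comp (-(X ^ q)) ∣ Q ∨ (cyclotomic q ℤ).comp (-(X ^ p)) ∣ Q := by
  have hn : 0 < p * q := Nat.mul_pos hp.pos hq.pos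
  have hrel := antiExt_relation hn hdeg
    ((cyclotomic_dvd_X_pow_mul_add_one_dvd hp hq hop hoq hpq).2.trans (mul_dvd_mul_left _ hdvd))
  have hval : ∀ k, antiExt (p * q) Q k = 1 ∨ antiExt (p * q) Q k = -1 := by
    intro k
    rcases neg_one_pow_eq_or ℤ (k / (p * q)) with h | h <;>
      rcases hcoeff _ (Nat.mod_lt k hn) with h' | h' <;> simp [antiExt, h, h']
  by_cases hD : ∀ k, antiExt (p * q) Q (k + p) + antiExt (p * q) Q k = 0
  · exact Or.inr (dvd_of_antiExt_antiperiodic hn hdeg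
      (X_pow_add_one_mul_cyclotomic_comp hq hoq) hD)
  by_cases hE : ∀ k, antiExt (p * q) Q (k + q) + antiExt (p * q) Q k = 0
  · exact Or.inl (dvd_of_antiExt_antiperiodic hn hdeg
      (by rw [X_pow_add_one_mul_cyclotomic_comp hp hop, mul_comm]) hE)
  push Not at hD hE
  obtain ⟨a, ha⟩ := hD
  obtain ⟨b, hb⟩ := hE
  obtain ⟨r, hra, hrb⟩ := Nat.chineseRemainder ((Nat.coprime_primes hq hp).2 hpq.symm) a b
  have shift : ∀ {m c : ℕ}, c ≤ a + b → m ∣ p * q → r ≡ c [MOD m] →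
      ∃ j, r + (a + b) * (p * q) = c + j * m := by
    intro m c hc hmn hrc
    have hle : c ≤ r + (a + b) * (p * q) := by nlinarith
    have hmod : c ≡ r + (a + b) * (p * q) [MOD m] := by
      simpa using hrc.symm.add (Nat.modEq_zero_iff_dvd.2 (hmn.mul_left (a + b))).symm
    obtain ⟨j, hj⟩ := (Nat.modEq_iff_dvd' hle).1 hmod
    exact ⟨j, by rw [mul_comm j]; omega⟩
  obtain ⟨i, hi⟩ := shift (Nat.le_add_right a b) (Dvd.intro_left p rfl) hra
  obtain ⟨j, hj⟩ := shift (Nat.le_add_left b a) (Dvd.intro q rfl) hrb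
  have hD' := ne_zero_of_antiperiodic (m := q)
    (f := fun k => antiExt (p * q) Q (k + p) + antiExt (p * q) Q k) (fun k => by
      have := hrel k
      simp only [add_right_comm k q p]
      linarith) ha i
  have hE' := ne_zero_of_antiperiodic (m := p)
    (f := fun k => antiExt (p * q) Q (k + q) + antiExt (p * q) Q k) (fun k => by
      have := hrel k
      linarith) hb j
  simp only [← hi, ← hj] at hD' hE'
  generalize r + (a + b) * (p * q) = m at hD' hE'
  have h₀ := hrel m
  rcases hval m with h₁ | h₁ <;> rcases hval (m + p) with h₂ | h₂ <;>
    rcases hval (m + q) with h₃ | h₃ <;> rcases hval (m + p + q) with h₄ | h₄ <;>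
    simp [h₁, h₂, h₃, h₄] at h₀ hD' hE'

/-- Twice the partial coefficient sums of a Reinhardt polynomial, minus one, take the value of the
last nonzero coefficient reached. -/
theorem IsReinhardt.exists_last_ne_zero {n : ℕ} {F : ℤ[X]} (hF : IsReinhardt n F) (k : ℕ) :
    ∃ i ≤ k, F.coeff i ≠ 0 ∧ (∀ j, i < j → j ≤ k → F.coeff j = 0) ∧
      2 * ∑ j ∈ Finset.range (k + 1), F.coeff j - 1 = F.coeff i := by
  obtain ⟨h0, -, -, halt, -⟩ := hF
  induction k with
  | zero => exact ⟨0, le_rfl, by simp [h0], fun j _ _ => by omega, by simp [h0]⟩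
  | succ k ih =>
    obtain ⟨i, hik, hi, hz, hs⟩ := ih
    rw [Finset.sum_range_succ]
    by_cases hk : F.coeff (k + 1) = 0
    · refine ⟨i, by omega, hi, fun j hij hjk => ?_, by rw [hk, add_zero, hs]⟩
      rcases Nat.of_le_succ hjk with h | rfl
      exacts [hz j hij h, hk]
    · have := halt i (k + 1) (by omega) hi hk fun j hij hjk => hz j hij (by omega)
      exact ⟨k + 1, le_rfl, hk, fun j _ _ => by omega, by linarith⟩

/-- A Reinhardt polynomial `F` comes from a polynomial `Q` with coefficients `±1`. -/
theorem IsReinhardt.exists_one_sub_X_mul {n : ℕ} (hn : 0 < n) {F : ℤ[X]} (hF : IsReinhardt n F) :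
    ∃ Q : ℤ[X], (∀ k, n ≤ k → Q.coeff k = 0) ∧
      (∀ k, k < n → Q.coeff k = 1 ∨ Q.coeff k = -1) ∧
      (1 - X) * Q = 2 * F - (X ^ n + 1) := by
  set s : ℕ → ℤ := fun k => 2 * ∑ j ∈ Finset.range (k + 1), F.coeff j - 1 with hs
  have hlast := hF.exists_last_ne_zero
  obtain ⟨h0, hdeg, hcoeff, -, -, hend, -⟩ := hF
  have hz : ∀ k, n ≤ k → F.coeff k = 0 := fun k hk =>
    coeff_eq_zero_of_degree_lt (hdeg.trans_le (by exact_mod_cast hk))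
  have hQ : ∀ k, (∑ i ∈ Finset.range n, C (s i) * X ^ i).coeff k = if k < n then s k else 0 := by
    intro k
    simp [coeff_X_pow]
  refine ⟨∑ i ∈ Finset.range n, C (s i) * X ^ i, fun k hk => ?_, fun k hk => ?_, ?_⟩
  · rw [hQ, if_neg (by omega)]
  · rw [hQ, if_pos hk]
    obtain ⟨i, -, hi, -, hsi⟩ := hlast k
    rcases hcoeff i with h | h | h
    exacts [Or.inr (hsi.trans h), absurd h hi, Or.inl (hsi.trans h)]
  · have hsn : s (n - 1) = 1 := by
      obtain ⟨i, -, hi, hzi, hsi⟩ := hlast (n - 1)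
      refine hsi.trans (hend i hi fun k hik => ?_)
      rcases lt_or_ge k n with h | h
      exacts [hzi k hik (by omega), hz k h]
    have two : (2 : ℤ[X]) = C 2 := rfl
    ext k
    rw [sub_mul, one_mul, two]
    cases k with
    | zero => simp [hn, hn.ne, hs, h0]
    | succ k =>
      simp only [coeff_sub, coeff_X_mul, hQ, coeff_C_mul, coeff_add, coeff_X_pow, coeff_one]
      rcases lt_trichotomy (k + 1) n with h | h | h
      · rw [if_pos h, if_pos (by omega), if_neg h.ne]
        simp only [hs, Finset.sum_range_succ _ (k + 1)]
        simp
        ring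
      · have : k = n - 1 := by omega
        subst this
        simp [h, hz n le_rfl, hsn, hn, hn.ne']
      · rw [if_neg h.not_gt, if_neg (by omega), if_neg h.ne', hz _ h.le]
        simp

/-- If `n = pq` with `p` and `q` distinct odd primes and `F` is a Reinhardt
polynomial for `n`, then `Φ_p(-z^q) ∣ F(z)` or `Φ_q(-z^p) ∣ F(z)` in `ℤ[z]`. -/
theorem reinhardt_pq_divides (p q : ℕ) (hp : p.Prime) (hq : q.Prime) (hop : Odd p)
    (hoq : Odd q) (hpq : p ≠ q) (F : Polynomial ℤ) (hF : IsReinhardt (p * q) F) :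
    (cyclotomic p ℤ).comp (-(X ^ q)) ∣ F ∨ (cyclotomic q ℤ).comp (-(X ^ p)) ∣ F := by
  have hn : 0 < p * q := Nat.mul_pos hp.pos hq.pos
  obtain ⟨Q, hdeg, hcoeff, hQ⟩ := hF.exists_one_sub_X_mul hn
  have hirr : Prime (cyclotomic (2 * (p * q)) ℤ) :=
    (cyclotomic.irreducible (by omega)).prime
  have hPhi : cyclotomic (2 * (p * q)) ℤ ∣ (1 - X) * Q := by
    rw [hQ]
    exact dvd_sub (hF.2.2.2.2.2.2.2.mul_left 2)
      (cyclotomic_dvd_X_pow_mul_add_one_dvd hp hq hop hoq hpq).1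
  have hPhi_not : ¬ cyclotomic (2 * (p * q)) ℤ ∣ 1 - X := fun h => by
    rw [← neg_sub, dvd_neg, ← C_1] at h
    have hle := natDegree_le_of_dvd h (X_sub_C_ne_zero 1)
    rw [natDegree_cyclotomic, natDegree_X_sub_C] at hle
    have hpos := Nat.totient_pos.2 (show 0 < 2 * (p * q) by omega)
    have := Nat.totient_eq_one_iff.1 (le_antisymm hle hpos)
    have := Nat.mul_le_mul hp.two_le hq.two_le
    omega
  have hQdvd : cyclotomic (2 * (p * q)) ℤ ∣ Q := (hirr.dvd_or_dvd hPhi).resolve_left hPhi_not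
  have finish : ∀ {R S : ℤ[X]}, S * R = X ^ (p * q) + 1 → R ∣ Q → R ∣ F := by
    intro R S hS hR
    have h2F : R ∣ C 2 * F := by
      have : C 2 * F = (1 - X) * Q + S * R := by
        rw [hQ, hS]
        simp
      rw [this]
      exact dvd_add (hR.mul_left _) (Dvd.intro_left S rfl)
    obtain ⟨A, hA⟩ := h2F
    have h2 : Prime (C 2 : ℤ[X]) := prime_C_iff.2 Int.prime_two
    rcases h2.dvd_or_dvd (Dvd.intro F hA) with h | ⟨B, rfl⟩
    · have h' := C_dvd_iff_dvd_coeff _ _ |>.1 ((h.mul_left S).trans hS.dvd) 0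
      simp [hn.ne] at h'
    · exact ⟨B, mul_left_cancel₀ h2.ne_zero (by rw [hA]; ring)⟩
  refine (dvd_or_dvd_of_coeff_eq_one_or_neg_one hp hq hop hoq hpq hdeg hcoeff hQdvd).imp
    (finish (S := X ^ q + 1) ?_) (finish (X_pow_add_one_mul_cyclotomic_comp hq hoq))
  rw [X_pow_add_one_mul_cyclotomic_comp hp hop, mul_comm]
end

section
/- Let n = pq with p and q distinct odd primes, and let F be a Reinhardt polynomial for n. Then there exist polynomials f_1, f_2 ∈ ℤ[z] with deg f_1 < q, deg f_2 < p, every coefficient of f_1 and of f_2 lying in {−1, 0, 1}, and F(z) = f_1(z)·Φ_p(−z^q) + f_2(z)·Φ_q(−z^p). -/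
open Polynomial

/-- Geometric sums of coprime lengths are coprime. -/
theorem isCoprime_geom_sum {R : Type*} [CommRing R] (x : R) (m n : ℕ) (h : m.Coprime n) :
    IsCoprime (∑ i ∈ Finset.range m, x ^ i) (∑ i ∈ Finset.range n, x ^ i) := by
  induction m, n using Nat.gcd.induction with
  | H0 n =>
    obtain rfl : n = 1 := by simpa using h
    simpa using isCoprime_one_right
  | H1 m n _ ih =>
    have hc : (n % m).Coprime m := by
      rw [Nat.Coprime, ← Nat.gcd_rec]; exact h
    have key : ∑ i ∈ Finset.range n, x ^ i = ∑ i ∈ Finset.range (n % m), x ^ i +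
        (∑ i ∈ Finset.range m, x ^ i) *
          (x ^ (n % m) * ∑ i ∈ Finset.range (n / m), (x ^ m) ^ i) := by
      have hsplit (k : ℕ) : ∑ i ∈ Finset.range (m * k), x ^ i =
          (∑ i ∈ Finset.range m, x ^ i) * ∑ i ∈ Finset.range k, (x ^ m) ^ i := by
        induction k with
        | zero => simp
        | succ k ihk =>
          rw [Nat.mul_succ, Finset.sum_range_add, ihk, Finset.sum_range_succ _ k, mul_add,
            Finset.sum_mul _ _ ((x ^ m) ^ k)]
          simp only [pow_add, pow_mul, mul_comm]
      conv_lhs => rw [← Nat.mod_add_div n m, Finset.sum_range_add]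
      simp only [pow_add, ← Finset.mul_sum]
      rw [hsplit]
      ring
    rw [key]
    exact (ih hc).symm.add_mul_left_right _

theorem cyclotomic_comp_X_pow_mul_sub_one {p : ℕ} (hp : p.Prime) (q : ℕ) :
    (cyclotomic p ℤ).comp (X ^ q) * (X ^ q - 1) = X ^ (p * q) - 1 := by
  have := Fact.mk hp
  rw [← sub_eq_zero, cyclotomic_prime, ← expand_eq_comp_X_pow, map_sum]
  simp only [map_pow, expand_X]
  rw [geom_sum_mul, ← pow_mul, mul_comm q p, sub_self]

theorem geom_sum_mul_cyclotomic_comp {p : ℕ} (hp : p.Prime) (q : ℕ) :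
    (∑ i ∈ Finset.range q, X ^ i) * (cyclotomic p ℤ).comp (X ^ q) =
      ∑ i ∈ Finset.range (p * q), X ^ i := by
  apply mul_right_cancel₀ (X_sub_C_ne_zero (1 : ℤ))
  rw [map_one, geom_sum_mul, mul_right_comm, geom_sum_mul, mul_comm,
    cyclotomic_comp_X_pow_mul_sub_one hp]

theorem degree_mul_cyclotomic_comp_lt {p q : ℕ} (hp : p.Prime) (hq : 0 < q) {A : ℤ[X]}
    (hA : A.degree < q) : (A * (cyclotomic p ℤ).comp (X ^ q)).degree < (p * q : ℕ) := by
  have h := congrArg degree (cyclotomic_comp_X_pow_mul_sub_one hp q)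
  rw [← C_1, degree_mul, degree_X_pow_sub_C hq,
    degree_X_pow_sub_C (Nat.mul_pos hp.pos hq)] at h
  rw [degree_mul, ← h, add_comm]
  refine WithBot.add_lt_add_left ?_ hA
  intro hbot
  rw [hbot, WithBot.bot_add] at h
  exact WithBot.natCast_ne_bot _ h.symm

theorem coeff_mul_cyclotomic_comp {p q : ℕ} (hp : p.Prime) (hq : 0 < q) {A : ℤ[X]}
    (hA : A.degree < q) {k : ℕ} (hk : k < p * q) :
    (A * (cyclotomic p ℤ).comp (X ^ q)).coeff k = A.coeff (k % q) := by
  have := Fact.mk hp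
  have hdiv := Nat.mod_add_div k q
  rw [cyclotomic_prime, ← expand_eq_comp_X_pow, map_sum, Finset.mul_sum, finsetSum_coeff]
  simp only [map_pow, expand_X, ← pow_mul, coeff_mul_X_pow']
  rw [Finset.sum_eq_single (k / q)]
  · rw [if_pos (by lia)]
    congr 1
    lia
  · intro m _ hm
    split_ifs with hle
    · apply coeff_eq_zero_of_degree_lt
      refine hA.trans_le ?_
      norm_cast
      have hlt : m < k / q :=
        lt_of_le_of_ne ((Nat.le_div_iff_mul_le hq).2 (by rwa [mul_comm])) hm
      have := Nat.mul_le_mul_left q (Nat.succ_le_of_lt hlt)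
      rw [Nat.mul_succ] at this
      lia
    · rfl
  · intro h
    exact absurd (Finset.mem_range.2 ((Nat.div_lt_iff_lt_mul hq).2 hk)) h

/-- A multiple of `Φ_{pq}` of degree less than `pq` is a combination of `Φ_p(X ^ q)` and
`Φ_q(X ^ p)` with coefficients of degree less than `q` and `p`. -/
theorem exists_eq_of_cyclotomic_dvd {p q : ℕ} (hp : p.Prime) (hq : q.Prime) (hpq : p ≠ q)
    {G : ℤ[X]} (hG : G.degree < (p * q : ℕ)) (hdvd : cyclotomic (p * q) ℤ ∣ G) :
    ∃ A B : ℤ[X], A.degree < q ∧ B.degree < p ∧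
      G = A * (cyclotomic p ℤ).comp (X ^ q) + B * (cyclotomic q ℤ).comp (X ^ p) := by
  have := Fact.mk hp
  have := Fact.mk hq
  have hpe : (cyclotomic p ℤ).comp (X ^ q) = cyclotomic (p * q) ℤ * cyclotomic p ℤ := by
    rw [← expand_eq_comp_X_pow, cyclotomic_expand_eq_cyclotomic_mul hq]
    exact fun h => hpq ((Nat.prime_dvd_prime_iff_eq hq hp).1 h).symm
  have hqe : (cyclotomic q ℤ).comp (X ^ p) = cyclotomic (p * q) ℤ * cyclotomic q ℤ := by
    rw [← expand_eq_comp_X_pow, cyclotomic_expand_eq_cyclotomic_mul hp, mul_comm q p]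
    exact fun h => hpq ((Nat.prime_dvd_prime_iff_eq hp hq).1 h)
  have hcop : IsCoprime (cyclotomic p ℤ) (cyclotomic q ℤ) := by
    rw [cyclotomic_prime, cyclotomic_prime]
    exact isCoprime_geom_sum X p q ((Nat.coprime_primes hp hq).2 hpq)
  obtain ⟨u, v, huv⟩ := hcop
  obtain ⟨H, rfl⟩ := hdvd
  have hmp : (X ^ p - 1 : ℤ[X]).Monic := monic_X_pow_sub_C 1 hp.ne_zero
  have hmq : (X ^ q - 1 : ℤ[X]).Monic := monic_X_pow_sub_C 1 hq.ne_zero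
  have hmn : (X ^ (p * q) - 1 : ℤ[X]).Monic :=
    monic_X_pow_sub_C 1 (Nat.mul_pos hp.pos hq.pos).ne'
  have hA : ((H * u) %ₘ (X ^ q - 1)).degree < q := by
    refine (degree_modByMonic_lt _ hmq).trans_eq ?_
    rw [← C_1, degree_X_pow_sub_C hq.pos]
  have hB : ((H * v) %ₘ (X ^ p - 1)).degree < p := by
    refine (degree_modByMonic_lt _ hmp).trans_eq ?_
    rw [← C_1, degree_X_pow_sub_C hp.pos]
  refine ⟨_, _, hA, hB, ?_⟩
  rw [← sub_eq_zero]
  refine eq_zero_of_dvd_of_degree_lt (p := X ^ (p * q) - 1) ?_ ?_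
  · have h1 := modByMonic_add_div (H * u) (X ^ q - 1)
    have h2 := modByMonic_add_div (H * v) (X ^ p - 1)
    have h3 := cyclotomic_comp_X_pow_mul_sub_one hp q
    have h4 := cyclotomic_comp_X_pow_mul_sub_one hq p
    rw [mul_comm q p] at h4
    refine ⟨(H * u) /ₘ (X ^ q - 1) + (H * v) /ₘ (X ^ p - 1), ?_⟩
    linear_combination (-(cyclotomic (p * q) ℤ) * H) * huv - H * u * hpe - H * v * hqe
      - (cyclotomic p ℤ).comp (X ^ q) * h1 - (cyclotomic q ℤ).comp (X ^ p) * h2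
      + (H * u /ₘ (X ^ q - 1)) * h3 + (H * v /ₘ (X ^ p - 1)) * h4
  · rw [← C_1, degree_X_pow_sub_C (Nat.mul_pos hp.pos hq.pos)]
    refine (degree_sub_le _ _).trans_lt (max_lt hG ((degree_add_le _ _).trans_lt (max_lt ?_ ?_)))
    · exact degree_mul_cyclotomic_comp_lt hp hq.pos hA
    · rw [mul_comm p q]
      exact degree_mul_cyclotomic_comp_lt hq hp.pos hB

theorem cyclotomic_dvd_comp_neg_X {n : ℕ} (hn : Odd n) {F : ℤ[X]}
    (h : cyclotomic (2 * n) ℤ ∣ F) : cyclotomic n ℤ ∣ F.comp (-X) := by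
  have hn0 : n ≠ 0 := hn.pos.ne'
  have hζ := Complex.isPrimitiveRoot_exp n hn0
  set ζ := Complex.exp (2 * Real.pi * Complex.I / n)
  have hneg : IsPrimitiveRoot (-ζ) (2 * n) := by
    rw [IsPrimitiveRoot.iff_orderOf, neg_eq_neg_one_mul,
      (Commute.all _ _).orderOf_mul_eq_mul_orderOf_of_coprime, ← hζ.eq_orderOf]
    · simp [orderOf_neg_one, ringChar.eq_zero]
    · rw [← hζ.eq_orderOf]
      simpa [orderOf_neg_one, ringChar.eq_zero] using hn
  rw [cyclotomic_eq_minpoly hζ hn.pos]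
  refine minpoly.isIntegrallyClosed_dvd (hζ.isIntegral hn.pos) ?_
  obtain ⟨H, rfl⟩ := h
  have hroot : aeval (-ζ) (cyclotomic (2 * n) ℤ) = 0 := by
    rw [cyclotomic_eq_minpoly hneg (by lia)]
    exact minpoly.aeval _ _
  rw [aeval_comp]
  simp [hroot]

/-- If all sums `a i + b j` lie in `[-1, 1]`, then a common shift moves both families into
`[-1, 1]`. -/
theorem exists_shift_mem_Icc {s t : Finset ℕ} (hs : s.Nonempty) (ht : t.Nonempty) {a b : ℕ → ℤ}
    (h : ∀ i ∈ s, ∀ j ∈ t, a i + b j ∈ Set.Icc (-1) 1) :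
    ∃ c : ℤ, (∀ i ∈ s, a i - c ∈ Set.Icc (-1) 1) ∧ ∀ j ∈ t, b j + c ∈ Set.Icc (-1) 1 := by
  simp only [Set.mem_Icc] at h ⊢
  obtain ⟨i₀, hi₀, hmax⟩ := s.exists_max_image a hs
  obtain ⟨j₀, hj₀, hmin⟩ := t.exists_min_image b ht
  refine ⟨max (a i₀ - 1) (-1 - b j₀), fun i hi => ?_, fun j hj => ?_⟩
  · have := h i hi j₀ hj₀
    have := h i₀ hi₀ j₀ hj₀
    have := hmax i hi
    obtain ⟨j, hj⟩ := ht
    have := h i hi j hj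
    have := h i₀ hi₀ j hj
    lia
  · have := h i₀ hi₀ j hj
    have := h i₀ hi₀ j₀ hj₀
    have := hmin j hj
    lia

theorem coeff_comp_neg_X_mem_Icc {f : ℤ[X]} (h : ∀ k, f.coeff k ∈ Set.Icc (-1) 1) (k : ℕ) :
    (f.comp (-X)).coeff k ∈ Set.Icc (-1) 1 := by
  have := h k
  rw [Set.mem_Icc] at this ⊢
  rw [show (-X : ℤ[X]) = C (-1) * X by simp, comp_C_mul_X_coeff]
  rcases neg_one_pow_eq_or ℤ k with hk | hk <;> rw [hk] <;> lia

theorem coeff_geom_sum (n k : ℕ) :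
    (∑ i ∈ Finset.range n, (X : ℤ[X]) ^ i).coeff k = if k < n then 1 else 0 := by
  simp [coeff_X_pow]

/-- The coefficient bounds alone allow the cofactors of `Φ_p(X ^ q)` and `Φ_q(X ^ p)` to be
chosen with coefficients in `[-1, 1]`. -/
theorem exists_bounded_of_cyclotomic_dvd {p q : ℕ} (hp : p.Prime) (hq : q.Prime) (hpq : p ≠ q)
    {G : ℤ[X]} (hG : G.degree < (p * q : ℕ)) (hdvd : cyclotomic (p * q) ℤ ∣ G)
    (hc : ∀ k, G.coeff k ∈ Set.Icc (-1) 1) :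
    ∃ A B : ℤ[X], A.degree < q ∧ B.degree < p ∧
      (∀ k, A.coeff k ∈ Set.Icc (-1) 1) ∧ (∀ k, B.coeff k ∈ Set.Icc (-1) 1) ∧
      G = A * (cyclotomic p ℤ).comp (X ^ q) + B * (cyclotomic q ℤ).comp (X ^ p) := by
  obtain ⟨A, B, hA, hB, rfl⟩ := exists_eq_of_cyclotomic_dvd hp hq hpq hG hdvd
  have hsum : ∀ i ∈ Finset.range q, ∀ j ∈ Finset.range p,
      A.coeff i + B.coeff j ∈ Set.Icc (-1) 1 := by
    intro i hi j hj
    rw [Finset.mem_range] at hi hj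
    have hcop : q.Coprime p := (Nat.coprime_primes hq hp).2 hpq.symm
    let k := Nat.chineseRemainder hcop i j
    have hk : (k : ℕ) < q * p := Nat.chineseRemainder_lt_mul hcop i j hq.ne_zero hp.ne_zero
    have hki : (k : ℕ) % q = i := by rw [k.2.1, Nat.mod_eq_of_lt hi]
    have hkj : (k : ℕ) % p = j := by rw [k.2.2, Nat.mod_eq_of_lt hj]
    have := hc k
    rwa [coeff_add, coeff_mul_cyclotomic_comp hp hq.pos hA (by rwa [mul_comm]),
      coeff_mul_cyclotomic_comp hq hp.pos hB hk, hki, hkj] at this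
  obtain ⟨c, hcA, hcB⟩ := exists_shift_mem_Icc (Finset.nonempty_range_iff.2 hq.ne_zero)
    (Finset.nonempty_range_iff.2 hp.ne_zero) hsum
  have hA0 (k : ℕ) (hk : q ≤ k) : A.coeff k = 0 :=
    coeff_eq_zero_of_degree_lt (hA.trans_le (by exact_mod_cast hk))
  have hB0 (k : ℕ) (hk : p ≤ k) : B.coeff k = 0 :=
    coeff_eq_zero_of_degree_lt (hB.trans_le (by exact_mod_cast hk))
  refine ⟨A - C c * ∑ i ∈ Finset.range q, X ^ i, B + C c * ∑ i ∈ Finset.range p, X ^ i,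
    ?_, ?_, fun k => ?_, fun k => ?_, ?_⟩
  · rw [degree_lt_iff_coeff_zero]
    intro k hk
    simp [hA0 k hk, hk]
  · rw [degree_lt_iff_coeff_zero]
    intro k hk
    simp [hB0 k hk, hk]
  · rw [coeff_sub, coeff_C_mul, coeff_geom_sum]
    split_ifs with hk
    · simpa using hcA k (Finset.mem_range.2 hk)
    · simp [hA0 k (not_lt.1 hk)]
  · rw [coeff_add, coeff_C_mul, coeff_geom_sum]
    split_ifs with hk
    · simpa using hcB k (Finset.mem_range.2 hk)
    · simp [hB0 k (not_lt.1 hk)]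
  · have h1 := geom_sum_mul_cyclotomic_comp hp q
    have h2 := geom_sum_mul_cyclotomic_comp hq p
    rw [mul_comm q p] at h2
    linear_combination C c * h1 - C c * h2

/-- If `n = pq` with `p` and `q` distinct odd primes and `F` is a Reinhardt
polynomial for `n`, then there exist `f₁, f₂ ∈ ℤ[z]` with `deg f₁ < q`, `deg f₂ < p`, all
coefficients of `f₁` and `f₂` in `{-1, 0, 1}`, and `F = f₁·Φ_p(-z^q) + f₂·Φ_q(-z^p)`. -/
theorem reinhardt_pq_decomposition (p q : ℕ) (hp : p.Prime) (hq : q.Prime) (hop : Odd p)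
    (hoq : Odd q) (hpq : p ≠ q) (F : Polynomial ℤ) (hF : IsReinhardt (p * q) F) :
    ∃ f₁ f₂ : Polynomial ℤ,
      f₁.degree < (q : WithBot ℕ) ∧ f₂.degree < (p : WithBot ℕ) ∧
      (∀ k, f₁.coeff k ∈ ({-1, 0, 1} : Set ℤ)) ∧
      (∀ k, f₂.coeff k ∈ ({-1, 0, 1} : Set ℤ)) ∧
      F = f₁ * (cyclotomic p ℤ).comp (-(X ^ q)) + f₂ * (cyclotomic q ℤ).comp (-(X ^ p)) := by
  obtain ⟨-, hdeg, hcoeff, -, -, -, -, hdvd⟩ := hF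
  have hset : ({-1, 0, 1} : Set ℤ) = Set.Icc (-1) 1 := by
    ext x
    simp only [Set.mem_insert_iff, Set.mem_singleton_iff, Set.mem_Icc]
    lia
  rw [hset] at hcoeff ⊢
  obtain ⟨A, B, hA, hB, hAc, hBc, hG⟩ := exists_bounded_of_cyclotomic_dvd hp hq hpq
    (G := F.comp (-X)) (by rwa [degree_comp_neg_X])
    (cyclotomic_dvd_comp_neg_X (hop.mul hoq) hdvd) (coeff_comp_neg_X_mem_Icc hcoeff)
  refine ⟨A.comp (-X), B.comp (-X), by rwa [degree_comp_neg_X], by rwa [degree_comp_neg_X],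
    coeff_comp_neg_X_mem_Icc hAc, coeff_comp_neg_X_mem_Icc hBc, ?_⟩
  have h := congrArg (fun f : ℤ[X] => f.comp (-X)) hG
  simpa [comp_assoc, hop.neg_pow, hoq.neg_pow] using h
end

section
/- Let n = pqr, where p and q are distinct odd primes and r ≥ 2 is an integer. Then there exists a sporadic Reinhardt polynomial for n, i.e., a Reinhardt polynomial F for n such that for every odd divisor d > 1 of n, F is not (n/d)-antiperiodic. -/
open Polynomial

/-- The polynomial of degree less than `n` whose coefficients are the halved successive
differences of `e`. -/
noncomputable def halfDiffPoly (n : ℕ) (e : ℕ → ℤ) : ℤ[X] :=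
  ∑ k ∈ Finset.range n, C ((e (k + 1) - e k) / 2) * X ^ k

lemma coeff_halfDiffPoly (n : ℕ) (e : ℕ → ℤ) (k : ℕ) :
    (halfDiffPoly n e).coeff k = if k < n then (e (k + 1) - e k) / 2 else 0 := by
  simp [halfDiffPoly, coeff_X_pow]

lemma degree_halfDiffPoly_lt (n : ℕ) (e : ℕ → ℤ) :
    (halfDiffPoly n e).degree < (n : WithBot ℕ) := by
  rw [degree_lt_iff_coeff_zero]
  intro m hm
  rw [coeff_halfDiffPoly, if_neg (by omega)]

/-- A sequence is constant along an interval on which its halved differences vanish. -/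
lemma eq_of_coeff_eq_zero {n : ℕ} {e : ℕ → ℤ} (he : ∀ k, e k = 1 ∨ e k = -1) {i j : ℕ}
    (hij : i < j) (hj : j ≤ n)
    (h : ∀ k, i < k → k < j → (halfDiffPoly n e).coeff k = 0) : e (i + 1) = e j := by
  induction j, hij using Nat.le_induction with
  | base => rfl
  | succ m hm ih =>
    rw [ih (by omega) fun k h1 h2 => h k h1 (by omega)]
    have h0 := h m (by omega) (by omega)
    rw [coeff_halfDiffPoly, if_pos (by omega)] at h0
    rcases he m with h1 | h1 <;> rcases he (m + 1) with h2 | h2 <;> simp_all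

lemma coeff_halfDiffPoly_ne_zero {n : ℕ} {e : ℕ → ℤ} (he : ∀ k, e k = 1 ∨ e k = -1) {k : ℕ}
    (h : (halfDiffPoly n e).coeff k ≠ 0) :
    k < n ∧ (halfDiffPoly n e).coeff k = e (k + 1) ∧ e (k + 1) = -e k := by
  rw [coeff_halfDiffPoly] at h ⊢
  split_ifs at h ⊢ with hk
  · rcases he k with h1 | h1 <;> rcases he (k + 1) with h2 | h2 <;> simp_all
  · simp at h

lemma odd_card_support_halfDiffPoly {n : ℕ} {e : ℕ → ℤ} (he : ∀ k, e k = 1 ∨ e k = -1)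
    (h0 : e 0 = -1) (hn : e n = 1) : Odd (halfDiffPoly n e).support.card := by
  have hsum : ∑ k ∈ Finset.range n, (halfDiffPoly n e).coeff k = 1 := by
    have h2 : 2 * ∑ k ∈ Finset.range n, (halfDiffPoly n e).coeff k = e n - e 0 := by
      rw [← Finset.sum_range_sub, Finset.mul_sum]
      refine Finset.sum_congr rfl fun k hk => ?_
      rw [coeff_halfDiffPoly, if_pos (Finset.mem_range.mp hk)]
      rcases he k with h1 | h1 <;> rcases he (k + 1) with h2 | h2 <;> simp [h1, h2]
    rw [h0, hn] at h2
    omega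
  have hsub : (halfDiffPoly n e).support ⊆ Finset.range n := fun k hk =>
    Finset.mem_range.mpr (coeff_halfDiffPoly_ne_zero he (mem_support_iff.mp hk)).1
  rw [← Finset.sum_subset hsub fun k _ hk => notMem_support_iff.mp hk] at hsum
  have hmod : ((∑ k ∈ (halfDiffPoly n e).support, (halfDiffPoly n e).coeff k : ℤ) : ZMod 2) =
      (halfDiffPoly n e).support.card := by
    rw [Finset.card_eq_sum_ones]
    push_cast
    refine Finset.sum_congr rfl fun k hk => ?_
    obtain ⟨-, h1, -⟩ := coeff_halfDiffPoly_ne_zero he (mem_support_iff.mp hk)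
    rcases he (k + 1) with h2 | h2 <;> rw [h1, h2] <;> decide
  rw [hsum] at hmod
  rw [← ZMod.natCast_eq_one_iff_odd, ← hmod]
  rfl

/-- Twice `halfDiffPoly n e` is `(1 - z) ∑ e (k + 1) z ^ k` modulo `z ^ n + 1`. -/
lemma two_mul_aeval_halfDiffPoly {n : ℕ} {e : ℕ → ℤ} (he : ∀ k, e k = 1 ∨ e k = -1)
    (z : ℂ) :
    2 * aeval z (halfDiffPoly n e) =
      (1 - z) * (∑ k ∈ Finset.range n, (e (k + 1) : ℂ) * z ^ k) + e n * z ^ n - e 0 := by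
  induction n with
  | zero => simp [halfDiffPoly]
  | succ n ih =>
    have hs : halfDiffPoly (n + 1) e =
        halfDiffPoly n e + C ((e (n + 1) - e n) / 2) * X ^ n := Finset.sum_range_succ _ _
    have hc : (2 : ℂ) * (((e (n + 1) - e n) / 2 : ℤ) : ℂ) = e (n + 1) - e n := by
      rcases he n with h1 | h1 <;> rcases he (n + 1) with h2 | h2 <;> simp [h1, h2] <;> norm_num
    rw [hs, map_add, mul_add, ih, Finset.sum_range_succ]
    simp only [map_mul, map_pow, aeval_X, eq_intCast, map_intCast]
    linear_combination z ^ n * hc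

lemma cyclotomic_dvd_of_aeval_eq_zero {m : ℕ} (hm : 0 < m) {z : ℂ} (hz : IsPrimitiveRoot z m)
    {F : ℤ[X]} (h : aeval z F = 0) : cyclotomic m ℤ ∣ F := by
  rw [cyclotomic_eq_minpoly hz hm]
  exact minpoly.isIntegrallyClosed_dvd (hz.isIntegral hm) h

lemma sum_range_add_of_periodic {M : Type*} [AddCommGroup M] {n : ℕ} {h : ℕ → M}
    (hp : ∀ k, h (k + n) = h k) (m : ℕ) :
    ∑ k ∈ Finset.range n, h (k + m) = ∑ k ∈ Finset.range n, h k := by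
  induction m with
  | zero => simp
  | succ m ih =>
    rw [← ih]
    have h1 := Finset.sum_range_succ (fun k => h (k + m)) n
    rw [Finset.sum_range_succ'] at h1
    have h2 : h (n + m) = h (0 + m) := by rw [zero_add, add_comm, hp]
    rw [h2] at h1
    simpa only [add_right_comm _ 1 m, ← add_assoc] using add_right_cancel h1

/-- A sequence antiperiodic with respect to `n` and `m` is orthogonal to the powers of `z`
when `z ^ n = -1` and `z ^ m ≠ -1`. -/
lemma sum_mul_pow_eq_zero {n m : ℕ} {a : ℕ → ℂ} {z : ℂ} (hn : ∀ k, a (k + n) = -a k)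
    (hm : ∀ k, a (k + m) = -a k) (hzn : z ^ n = -1) (hzm : z ^ m ≠ -1) :
    ∑ k ∈ Finset.range n, a k * z ^ k = 0 := by
  have hs := sum_range_add_of_periodic (n := n) (h := fun k => a k * z ^ k)
    (fun k => by simp only [hn, pow_add, hzn]; ring) m
  have hc : ∑ k ∈ Finset.range n, a (k + m) * z ^ (k + m) =
      -z ^ m * ∑ k ∈ Finset.range n, a k * z ^ k := by
    rw [Finset.mul_sum]
    refine Finset.sum_congr rfl fun k _ => ?_
    rw [hm, pow_add]
    ring
  rw [hc] at hs
  have h0 : (1 + z ^ m) * ∑ k ∈ Finset.range n, a k * z ^ k = 0 := by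
    linear_combination -hs
  refine (mul_eq_zero.mp h0).resolve_left fun h => hzm ?_
  linear_combination h

lemma isReinhardt_halfDiffPoly {n : ℕ} {e : ℕ → ℤ} (he : ∀ k, e k = 1 ∨ e k = -1)
    (hpos : 0 < n) (h0 : e 0 = -1) (h1 : e 1 = 1) (hn : e n = 1)
    (hdvd : cyclotomic (2 * n) ℤ ∣ halfDiffPoly n e) : IsReinhardt n (halfDiffPoly n e) := by
  have hc0 : (halfDiffPoly n e).coeff 0 = 1 := by
    simp [coeff_halfDiffPoly, hpos, h0, h1]
  refine ⟨hc0, degree_halfDiffPoly_lt n e, fun k => ?_, fun i j hij hi hj hz => ?_,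
    fun i _ hz => ?_, fun i hi hz => ?_, odd_card_support_halfDiffPoly he h0 hn, hdvd⟩
  · by_cases hk : (halfDiffPoly n e).coeff k = 0
    · simp [hk]
    · rw [(coeff_halfDiffPoly_ne_zero he hk).2.1]
      rcases he (k + 1) with h | h <;> simp [h]
  · obtain ⟨-, hi1, -⟩ := coeff_halfDiffPoly_ne_zero he hi
    obtain ⟨hjn, hj1, hj2⟩ := coeff_halfDiffPoly_ne_zero he hj
    rw [hi1, hj1, hj2, eq_of_coeff_eq_zero he hij hjn.le hz]
  · rcases Nat.eq_zero_or_pos i with rfl | hi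
    · exact hc0
    · simp [hz 0 hi] at hc0
  · obtain ⟨hin, hi1, -⟩ := coeff_halfDiffPoly_ne_zero he hi
    rw [hi1, eq_of_coeff_eq_zero he hin le_rfl fun k hk _ => hz k hk, hn]

lemma uF_halfDiffPoly_natCast {n : ℕ} (hpos : 0 < n) {e : ℕ → ℤ}
    (he : ∀ k, e k = 1 ∨ e k = -1) (hn : ∀ k, e (k + n) = -e k) (k : ℕ) :
    uF n (halfDiffPoly n e) (k : ZMod (2 * n)) = (e (k + 1) - e k) / 2 := by
  have hper : Function.Periodic (fun k => (e (k + 1) - e k) / 2) (2 * n) := fun k => by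
    have h2 : ∀ k, e (k + 2 * n) = e k := fun k => by
      rw [two_mul, ← add_assoc, hn, hn, neg_neg]
    simp only [add_right_comm k _ 1, h2]
  rw [← hper.map_mod_nat k, uF, ZMod.val_natCast]
  have hlt : k % (2 * n) < 2 * n := Nat.mod_lt _ (by omega)
  generalize k % (2 * n) = m at hlt ⊢
  split_ifs with hm
  · rw [coeff_halfDiffPoly, if_pos hm]
  · obtain ⟨l, rfl⟩ := Nat.exists_eq_add_of_le' (not_lt.mp hm)
    rw [Nat.add_sub_cancel, coeff_halfDiffPoly, if_pos (by omega)]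
    simp only [add_right_comm l _ 1, hn]
    rcases he l with h1 | h1 <;> rcases he (l + 1) with h2 | h2 <;> simp [h1, h2]

/-- Antiperiodicity of the difference sequence passes to the sequence itself. -/
lemma antiperiodic_of_antiper_halfDiffPoly {n : ℕ} (hpos : 0 < n) {e : ℕ → ℤ}
    (he : ∀ k, e k = 1 ∨ e k = -1) (hn : ∀ k, e (k + n) = -e k) {t : ℕ}
    (ht : Antiper n (halfDiffPoly n e) t) (k : ℕ) : e (k + t) = -e k := by
  have hstep : ∀ k, e (k + 1 + t) + e (k + 1) = e (k + t) + e k := fun k => by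
    have h := ht (k : ZMod (2 * n))
    rw [← Nat.cast_add, uF_halfDiffPoly_natCast hpos he hn,
      uF_halfDiffPoly_natCast hpos he hn, add_right_comm] at h
    rcases he k with h1 | h1 <;> rcases he (k + 1) with h2 | h2 <;>
      rcases he (k + t) with h3 | h3 <;> rcases he (k + 1 + t) with h4 | h4 <;>
      simp [h1, h2, h3, h4] at h ⊢
  have hconst : ∀ k, e (k + t) + e k = e (0 + t) + e 0 := fun k => by
    induction k with
    | zero => rfl
    | succ k ih => rw [hstep, ih]
  have h1 := hconst (k + n)
  rw [add_right_comm, hn, hn] at h1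
  have h2 := hconst k
  omega

/-- A sequence of signs, antiperiodic with respect to `q * r` on the multiples of `r` and with
respect to `p * r` off them. -/
def signSeq (p q r k : ℕ) : ℤ :=
  (-1) ^ (k / r) *
    if k % r = 0 then (if k / r % q = 1 then -1 else 1)
    else if k % r = 1 ∧ k / r % p = 0 then -1 else 1

lemma signSeq_eq_one_or (p q r k : ℕ) : signSeq p q r k = 1 ∨ signSeq p q r k = -1 := by
  unfold signSeq
  rcases neg_one_pow_eq_or ℤ (k / r) with h | h <;> rw [h] <;> split_ifs <;> simp

lemma signSeq_add {p q r k m : ℕ} (hr : 0 < r) (hm : Odd m) (h0 : k % r = 0 → q ∣ m)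
    (h1 : k % r ≠ 0 → p ∣ m) : signSeq p q r (k + m * r) = -signSeq p q r k := by
  simp only [signSeq, Nat.add_mul_div_right _ _ hr, Nat.add_mul_mod_self_right, pow_add,
    hm.neg_one_pow]
  by_cases hk : k % r = 0
  · obtain ⟨c, rfl⟩ := h0 hk
    simp only [hk, if_true, Nat.add_mul_mod_self_left]
    ring
  · obtain ⟨c, rfl⟩ := h1 hk
    simp only [hk, if_false, Nat.add_mul_mod_self_left]
    ring

lemma dvd_of_signSeq_add_zero {p q r m : ℕ} (hr : 0 < r) (hq : 1 < q) (hm : Odd m)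
    (h : signSeq p q r (r + m * r) = -signSeq p q r r) : q ∣ m := by
  simp only [signSeq, Nat.add_mul_div_right _ _ hr, Nat.add_mul_mod_self_right, pow_add,
    hm.neg_one_pow, Nat.div_self hr, Nat.mod_self, Nat.mod_eq_of_lt hq] at h
  have h1 : (1 + m) % q = 1 := by
    by_contra hne
    simp [hne] at h
  have h2 : 1 + m ≡ 1 + 0 [MOD q] := by
    rw [Nat.ModEq, h1, add_zero, Nat.mod_eq_of_lt hq]
  exact (Nat.modEq_zero_iff_dvd).mp (Nat.ModEq.add_left_cancel' 1 h2)

lemma dvd_of_signSeq_add_one {p q r m : ℕ} (hr : 1 < r) (hm : Odd m)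
    (h : signSeq p q r (1 + m * r) = -signSeq p q r 1) : p ∣ m := by
  simp only [signSeq, Nat.add_mul_div_right _ _ (zero_lt_one.trans hr),
    Nat.add_mul_mod_self_right, pow_add, hm.neg_one_pow, Nat.div_eq_of_lt hr,
    Nat.mod_eq_of_lt hr] at h
  refine Nat.dvd_of_mod_eq_zero ?_
  by_contra hne
  simp [hne] at h

lemma not_antiperiodic_signSeq {p q r d : ℕ} (hp : p.Prime) (hq : q.Prime) (hop : Odd p)
    (hoq : Odd q) (hpq : p ≠ q) (hr : 2 ≤ r) (hd : d ∣ p * q * r) (hd1 : 1 < d)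
    (h : ∀ k, signSeq p q r (k + p * q * r / d) = -signSeq p q r k) : False := by
  obtain ⟨t, ht⟩ := hd
  rw [ht, Nat.mul_div_cancel_left _ (by omega)] at h
  by_cases hrt : r ∣ t
  · obtain ⟨m, rfl⟩ := hrt
    have hdm : p * q = d * m :=
      Nat.eq_of_mul_eq_mul_right (by omega : 0 < r) (by rw [ht]; ring)
    have hm : Odd m := Nat.Odd.of_mul_right (hdm ▸ hop.mul hoq)
    rw [mul_comm r m] at h
    have hqm : q ∣ m := dvd_of_signSeq_add_zero (by omega) hq.one_lt hm (h r)
    have hpm : p ∣ m := dvd_of_signSeq_add_one (by omega) hm (h 1)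
    have hdvd : p * q ∣ m :=
      ((Nat.coprime_primes hp hq).mpr hpq).mul_dvd_of_dvd_of_dvd hpm hqm
    have hm0 : 0 < m := hm.pos
    have hle := Nat.le_of_dvd hm0 hdvd
    nlinarith
  · have hmod : (r + t) % r ≠ 0 := by
      rwa [Nat.add_mod_left, Ne, ← Nat.dvd_iff_mod_eq_zero]
    have h1 : signSeq p q r (r + p * r) = -signSeq p q r r := by
      have h2 := signSeq_add (q := q) (k := r + t) (by omega) hop (fun h => absurd h hmod)
        fun _ => dvd_rfl
      rw [add_right_comm, h, h] at h2
      linarith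
    have hqp := dvd_of_signSeq_add_zero (by omega) hq.one_lt hop h1
    exact hpq ((Nat.prime_dvd_prime_iff_eq hq hp).mp hqp).symm

lemma sum_signSeq_mul_pow {p q r : ℕ} (hp : p.Prime) (hq : q.Prime) (hop : Odd p)
    (hoq : Odd q) (hr : 0 < r) {z : ℂ} (hz : IsPrimitiveRoot z (2 * (p * q * r))) :
    ∑ k ∈ Finset.range (p * q * r), (signSeq p q r k : ℂ) * z ^ k = 0 := by
  have hp1 := hp.one_lt
  have hq1 := hq.one_lt
  have hpow : ∀ m c, 0 < m → 1 < c → p * q * r = c * m → z ^ m ≠ -1 := fun m c hm hc h h1 => by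
    have h2 : z ^ (2 * m) = 1 := by rw [mul_comm, pow_mul, h1]; norm_num
    have h3 := Nat.le_of_dvd (by omega) (hz.dvd_of_pow_eq_one _ h2)
    rw [h] at h3
    nlinarith
  have hn0 : 0 < p * q * r := by positivity
  have hzn : z ^ (p * q * r) = -1 :=
    (hz.pow (by omega) (mul_comm 2 (p * q * r))).eq_neg_one_of_two_right
  have hadd := @signSeq_add p q r
  have ha := sum_mul_pow_eq_zero (n := p * q * r) (m := q * r) (z := z)
    (a := fun k => if k % r = 0 then (signSeq p q r k : ℂ) else 0)
    (fun k => by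
      by_cases hk : k % r = 0
      · simp [hk, hadd hr (hop.mul hoq) (fun _ => dvd_mul_left q p) fun h => absurd hk h]
      · simp [hk])
    (fun k => by
      by_cases hk : k % r = 0
      · simp [hk, hadd hr hoq (fun _ => dvd_rfl) fun h => absurd hk h]
      · simp [hk])
    hzn (hpow _ p (by positivity) hp1 (mul_assoc p q r))
  have hb := sum_mul_pow_eq_zero (n := p * q * r) (m := p * r) (z := z)
    (a := fun k => if k % r = 0 then 0 else (signSeq p q r k : ℂ))
    (fun k => by
      by_cases hk : k % r = 0
      · simp [hk]
      · simp [hk, hadd hr (hop.mul hoq) (fun h => absurd h hk) fun _ => dvd_mul_right p q])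
    (fun k => by
      by_cases hk : k % r = 0
      · simp [hk]
      · simp [hk, hadd hr hop (fun h => absurd h hk) fun _ => dvd_rfl])
    hzn (hpow _ q (by positivity) hq1 (by ring))
  rw [← (congrArg₂ (· + ·) ha hb).trans (add_zero 0), ← Finset.sum_add_distrib]
  refine Finset.sum_congr rfl fun k _ => ?_
  split_ifs <;> simp

/-- If `n = pqr` with `p` and `q` distinct odd primes and `r ≥ 2`, then
there exists a sporadic Reinhardt polynomial for `n`. -/
theorem exists_sporadic (p q r : ℕ) (hp : p.Prime) (hq : q.Prime) (hop : Odd p)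
    (hoq : Odd q) (hpq : p ≠ q) (hr : 2 ≤ r) :
    ∃ F : Polynomial ℤ, IsReinhardt (p * q * r) F ∧ ¬IsPeriodicR (p * q * r) F := by
  have hp0 := hp.pos
  have hq0 := hq.pos
  have hr0 : 0 < r := by omega
  have hpos : 0 < p * q * r := by positivity
  have hn : ∀ k, signSeq p q r (k + p * q * r) = -signSeq p q r k := fun k =>
    signSeq_add hr0 (hop.mul hoq) (fun _ => dvd_mul_left q p) fun _ => dvd_mul_right p q
  have h0 : signSeq p q r 0 = 1 := by simp [signSeq]
  have hlast : signSeq p q r (p * q * r - 1) = 1 := by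
    obtain ⟨m, hm⟩ := Nat.exists_eq_add_of_lt (Nat.mul_pos hp0 hq0)
    have hk : p * q * r - 1 = (r - 1) + m * r := by
      rw [hm, zero_add, Nat.add_mul]; omega
    have hm_even : Even m := by
      have := hop.mul hoq
      rw [hm, zero_add] at this
      exact (Nat.odd_add_one.mp this) |> Nat.not_odd_iff_even.mp
    have hmp : m % p ≠ 0 := fun h => by
      have h1 : p ∣ m + 1 := ⟨q, by omega⟩
      have h2 := (Nat.dvd_add_right (Nat.dvd_of_mod_eq_zero h)).mp h1
      exact hp.one_lt.ne' (Nat.dvd_one.mp h2)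
    have hlt : r - 1 < r := by omega
    simp [signSeq, hk, Nat.add_mul_div_right _ _ hr0, Nat.div_eq_of_lt hlt,
      Nat.mod_eq_of_lt hlt, hm_even.neg_one_pow, hmp, (show ¬r - 1 = 0 by omega)]
  let e : ℕ → ℤ := fun k => if k = 0 then -1 else signSeq p q r (k - 1)
  have he : ∀ k, e k = 1 ∨ e k = -1 := fun k => by
    by_cases hk : k = 0
    · simp [e, hk]
    · simpa [e, hk] using signSeq_eq_one_or p q r (k - 1)
  have hen : ∀ k, e (k + p * q * r) = -e k := fun k => by
    rcases k with _ | k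
    · simp [e, hpos.ne', hlast]
    · simpa [e, add_right_comm k 1] using hn k
  have hen1 : e (p * q * r) = 1 := by simpa [e] using hen 0
  refine ⟨halfDiffPoly (p * q * r) e,
    isReinhardt_halfDiffPoly he hpos rfl (by simp [e, h0]) hen1 ?_, ?_⟩
  · have hz := Complex.isPrimitiveRoot_exp (2 * (p * q * r)) (by omega)
    refine cyclotomic_dvd_of_aeval_eq_zero (by omega) hz ?_
    have h2 := two_mul_aeval_halfDiffPoly (n := p * q * r) he
      (Complex.exp (2 * Real.pi * Complex.I / (2 * (p * q * r) : ℕ)))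
    have hzn := (hz.pow (by omega) (mul_comm 2 (p * q * r))).eq_neg_one_of_two_right
    have hsum := sum_signSeq_mul_pow hp hq hop hoq hr0 hz
    rw [hen1, hzn] at h2
    simp only [e, Nat.add_sub_cancel, Nat.add_eq_zero_iff, one_ne_zero, and_false, if_false,
      if_true, hsum] at h2
    simpa using h2
  · rintro ⟨d, hd, -, hd1, hanti⟩
    refine not_antiperiodic_signSeq hp hq hop hoq hpq hr hd hd1 fun k => ?_
    have h := antiperiodic_of_antiper_halfDiffPoly hpos he hen hanti (k + 1)
    simpa [e, add_right_comm k 1] using h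
end

section
/- Let n be a positive integer that is not a power of 2, and let p_1, …, p_s be the distinct odd prime divisors of n. For F ∈ ℤ[z], the cyclotomic polynomial Φ_{2n} divides F if and only if there exist polynomials f_0, f_1, …, f_s ∈ ℤ[z] such that F(z) = f_0(z)·(z^n + 1) + Σ_{i=1}^{s} f_i(z)·Φ_{p_i}(−z^{n/p_i}). -/
open Polynomial

theorem expand_cyclotomic_prime_mul {p : ℕ} (hp : p.Prime) (m : ℕ) :
    expand ℤ m (cyclotomic p ℤ) * (X ^ m - 1) = X ^ (m * p) - 1 := by
  have := Fact.mk hp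
  have h := congrArg (expand ℤ m) (cyclotomic_prime_mul_X_sub_one ℤ p)
  simpa [pow_mul] using h

theorem cyclotomic_dvd_expand_cyclotomic_prime {p m : ℕ} (hp : p.Prime) (hm : 0 < m) :
    cyclotomic (m * p) ℤ ∣ expand ℤ m (cyclotomic p ℤ) := by
  have h : m ∈ (m * p).properDivisors :=
    Nat.mem_properDivisors.2 ⟨dvd_mul_right _ _, lt_mul_of_one_lt_right hm hp.one_lt⟩
  have h' := X_pow_sub_one_mul_cyclotomic_dvd_X_pow_sub_one_of_dvd ℤ h
  rw [← expand_cyclotomic_prime_mul hp m, mul_comm (expand _ _ _)] at h'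
  exact (mul_dvd_mul_iff_left (X_pow_sub_C_ne_zero hm (1 : ℤ))).1 (by simpa using h')

theorem expand_cyclotomic_prime_eq_prod {q m : ℕ} (hq : q.Prime) (hm : 0 < m) (hqm : ¬q ∣ m) :
    expand ℤ m (cyclotomic q ℤ) = ∏ d ∈ m.divisors, cyclotomic (d * q) ℤ := by
  have hX : (X ^ m - 1 : ℤ[X]) ≠ 0 := by simpa using X_pow_sub_C_ne_zero hm (1 : ℤ)
  refine mul_right_cancel₀ hX ?_
  have h := congrArg (expand ℤ q) (prod_cyclotomic_eq_X_pow_sub_one hm ℤ)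
  rw [map_prod, Finset.prod_congr rfl fun d hd => cyclotomic_expand_eq_cyclotomic_mul hq
    (fun h => hqm (h.trans (Nat.dvd_of_mem_divisors hd))) ℤ, Finset.prod_mul_distrib,
    prod_cyclotomic_eq_X_pow_sub_one hm] at h
  rw [h, expand_cyclotomic_prime_mul hq, mul_comm m q]
  simp [pow_mul]

/-- If `x ^ m = 1` and `x` is a root of a divisor of `Φ_p(X ^ m)`, then `p = Φ_p(1)` vanishes. -/
theorem natCast_eq_zero_of_dvd_expand_cyclotomic {R : Type*} [CommRing R] {p m : ℕ}
    (hp : p.Prime) {x : R} (hx : x ^ m = 1) {f : ℤ[X]} (hf : aeval x f = 0)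
    (h : f ∣ expand ℤ m (cyclotomic p ℤ)) : (p : R) = 0 := by
  have := Fact.mk hp
  obtain ⟨g, hg⟩ := h
  have h := congrArg (aeval x) hg
  rw [expand_aeval, hx, map_mul, hf, zero_mul, aeval_def, eval₂_eq_eval_map,
    map_cyclotomic, eval_one_cyclotomic_prime] at h
  exact h

theorem isCoprime_cyclotomic_mul_prime {N q d : ℕ} (hN : 0 < N) (hq : q.Prime) (hqN : ¬q ∣ N)
    (hd : d ∈ N.properDivisors) : IsCoprime (cyclotomic N ℤ) (cyclotomic (d * q) ℤ) := by
  obtain ⟨⟨c, rfl⟩, hlt⟩ := Nat.mem_properDivisors.1 hd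
  obtain ⟨p, hp, e, rfl⟩ := Nat.exists_prime_and_dvd (n := c) (by rintro rfl; simp at hlt)
  obtain ⟨M, hM⟩ : ∃ M, M = d * e := ⟨_, rfl⟩
  have hNM : d * (p * e) = M * p := by rw [hM]; ring
  rw [hNM] at hqN hN ⊢
  have hMpos : 0 < M := Nat.pos_of_mul_pos_right hN
  have hqM : ¬q ∣ M := fun h => hqN (h.mul_right _)
  have hpq : p.Coprime q := (Nat.coprime_primes hp hq).2 (by rintro rfl; simp at hqN)
  rw [← Ideal.isCoprime_span_singleton_iff, Ideal.isCoprime_iff_sup_eq, ← Ideal.span_insert,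
    ← Ideal.Quotient.subsingleton_iff]
  set J := Ideal.span {cyclotomic (M * p) ℤ, cyclotomic (d * q) ℤ}
  have hev (f : ℤ[X]) : aeval (Ideal.Quotient.mk J X) f = Ideal.Quotient.mk J f := by
    have := aeval_algHom_apply (Ideal.Quotient.mkₐ ℤ J) X f
    simpa using this
  set x := Ideal.Quotient.mk J X
  have h1 : aeval x (cyclotomic (M * p) ℤ) = 0 := by
    rw [hev, Ideal.Quotient.eq_zero_iff_mem]
    exact Ideal.subset_span (by simp)
  have h2 : aeval x (cyclotomic (d * q) ℤ) = 0 := by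
    rw [hev, Ideal.Quotient.eq_zero_iff_mem]
    exact Ideal.subset_span (by simp)
  have hpow {k l : ℕ} (h : aeval x (cyclotomic k ℤ) = 0) (hkl : k ∣ l) : x ^ l = 1 := by
    obtain ⟨g, hg⟩ := cyclotomic.dvd_X_pow_sub_one k ℤ
    have h' := congrArg (aeval x) hg
    rw [map_mul, h, zero_mul] at h'
    obtain ⟨c, rfl⟩ := hkl
    rw [pow_mul, show x ^ k = 1 by simpa [sub_eq_zero] using h', one_pow]
  have hxM : x ^ M = 1 := by
    have := pow_gcd_eq_one.2 ⟨hpow h1 dvd_rfl, hpow (l := M * q) h2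
      (by rw [hM, mul_right_comm]; exact dvd_mul_right _ _)⟩
    rwa [Nat.gcd_mul_left, hpq, mul_one] at this
  have hp0 := natCast_eq_zero_of_dvd_expand_cyclotomic hp hxM h1
    (cyclotomic_dvd_expand_cyclotomic_prime hp hMpos)
  have hq0 : (q : ℤ[X] ⧸ J) = 0 := by
    refine natCast_eq_zero_of_dvd_expand_cyclotomic hq hxM h2 ?_
    rw [expand_cyclotomic_prime_eq_prod hq hMpos hqM]
    exact Finset.dvd_prod_of_mem (fun d => cyclotomic (d * q) ℤ)
      (Nat.mem_divisors.2 ⟨hM ▸ dvd_mul_right _ _, hMpos.ne'⟩)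
  have h10 := (Nat.isCoprime_iff_coprime.2 hpq).map (Int.castRingHom (ℤ[X] ⧸ J))
  simp only [eq_intCast, Int.cast_natCast, hp0, hq0, isCoprime_zero_left, isUnit_zero_iff] at h10
  exact subsingleton_of_zero_eq_one h10

/-- The ideal generated by `X ^ N - 1` and the `Φ_p(X ^ (N / p))`, for `p` a prime divisor
of `N`. -/
noncomputable def primeCyclotomicIdeal (N : ℕ) : Ideal ℤ[X] :=
  Ideal.span {g | g = X ^ N - 1 ∨
    ∃ p m : ℕ, p.Prime ∧ N = m * p ∧ g = expand ℤ m (cyclotomic p ℤ)}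

theorem expand_mem_primeCyclotomicIdeal {N : ℕ} (q : ℕ) {f : ℤ[X]}
    (hf : f ∈ primeCyclotomicIdeal N) : expand ℤ q f ∈ primeCyclotomicIdeal (q * N) := by
  suffices h : primeCyclotomicIdeal N ≤
      (primeCyclotomicIdeal (q * N)).comap (expand ℤ q).toRingHom from h hf
  refine Ideal.span_le.2 ?_
  rintro g (rfl | ⟨p, m, hp, rfl, rfl⟩)
  · exact Ideal.subset_span (Or.inl (by simp [pow_mul]))
  · exact Ideal.subset_span
      (Or.inr ⟨p, q * m, hp, (mul_assoc _ _ _).symm, expand_expand q m _⟩)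

theorem cyclotomic_mem_primeCyclotomicIdeal {N : ℕ} (hN : 0 < N) :
    cyclotomic N ℤ ∈ primeCyclotomicIdeal N := by
  induction N using induction_on_primes with
  | zero => simp at hN
  | one => exact Ideal.subset_span (Or.inl (by simp))
  | prime_mul q N hq ih =>
    have hNpos : 0 < N := Nat.pos_of_mul_pos_left hN
    have hexp := expand_mem_primeCyclotomicIdeal q (ih hNpos)
    by_cases hqN : q ∣ N
    · rwa [cyclotomic_expand_eq_cyclotomic hq hqN, mul_comm N q] at hexp
    rw [cyclotomic_expand_eq_cyclotomic_mul hq hqN] at hexp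
    have hgen : expand ℤ N (cyclotomic q ℤ) ∈ primeCyclotomicIdeal (q * N) :=
      Ideal.subset_span (Or.inr ⟨q, N, hq, mul_comm _ _, rfl⟩)
    rw [expand_cyclotomic_prime_eq_prod hq hNpos hqN, ← Nat.cons_self_properDivisors hNpos.ne',
      Finset.prod_cons] at hgen
    obtain ⟨a, b, hab⟩ := IsCoprime.prod_right (t := N.properDivisors)
      (s := fun d => cyclotomic (d * q) ℤ)
      fun d hd => isCoprime_cyclotomic_mul_prime hNpos hq hqN hd
    rw [mul_comm q N] at *
    have h := Ideal.add_mem _ (Ideal.mul_mem_left _ a hexp) (Ideal.mul_mem_left _ b hgen)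
    convert h using 1
    linear_combination -(cyclotomic (N * q) ℤ) * hab

theorem cyclotomic_prime_comp_neg_mul {p : ℕ} (hp : p.Prime) (hodd : Odd p) (w : ℤ[X]) :
    (cyclotomic p ℤ).comp (-w) * (w + 1) = w ^ p + 1 := by
  have := Fact.mk hp
  have h := congrArg (fun f => f.comp (-w)) (cyclotomic_prime_mul_X_sub_one ℤ p)
  simp [hodd.neg_pow] at h
  linear_combination -h

theorem cyclotomic_prime_comp_neg_dvd_expand {p : ℕ} (hp : p.Prime) (hodd : Odd p) (m : ℕ) :
    (cyclotomic p ℤ).comp (-(X ^ m)) ∣ expand ℤ (2 * m) (cyclotomic p ℤ) := by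
  have := Fact.mk hp
  have h : (cyclotomic p ℤ).comp (-X) ∣ expand ℤ 2 (cyclotomic p ℤ) := by
    refine ⟨cyclotomic p ℤ, mul_right_cancel₀ (b := X ^ 2 - 1)
      (by simpa using X_pow_sub_C_ne_zero two_pos (1 : ℤ)) ?_⟩
    rw [expand_cyclotomic_prime_mul hp]
    linear_combination (-(X ^ p - 1) : ℤ[X]) * cyclotomic_prime_comp_neg_mul hp hodd X -
      ((cyclotomic p ℤ).comp (-X) * (X + 1)) * cyclotomic_prime_mul_X_sub_one ℤ p
  obtain ⟨g, hg⟩ := h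
  refine ⟨expand ℤ m g, ?_⟩
  rw [mul_comm 2 m, ← expand_expand, hg, map_mul, expand_eq_comp_X_pow, comp_assoc]
  simp

theorem cyclotomic_two_mul_dvd_X_pow_add_one {n : ℕ} (hn : 0 < n) :
    cyclotomic (2 * n) ℤ ∣ X ^ n + 1 := by
  have h := cyclotomic_dvd_expand_cyclotomic_prime Nat.prime_two hn
  rw [mul_comm n 2] at h
  simpa using h

theorem cyclotomic_two_mul_dvd_cyclotomic_comp_neg {p m : ℕ} (hp : p.Prime) (hodd : Odd p)
    (hm : 0 < m) :
    cyclotomic (2 * (m * p)) ℤ ∣ (cyclotomic p ℤ).comp (-(X ^ m)) := by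
  have hpos : 0 < m * p := Nat.mul_pos hm hp.pos
  have h := cyclotomic_two_mul_dvd_X_pow_add_one hpos
  rw [pow_mul, ← cyclotomic_prime_comp_neg_mul hp hodd] at h
  refine ((cyclotomic.irreducible (by positivity)).prime.dvd_or_dvd h).resolve_right fun h' => ?_
  have hζ := Complex.isPrimitiveRoot_exp (2 * (m * p)) (by positivity)
  have h0 : aeval (Complex.exp (2 * Real.pi * Complex.I / (2 * (m * p) : ℕ)))
      (cyclotomic (2 * (m * p)) ℤ) = 0 := by
    rw [aeval_def, eval₂_eq_eval_map, map_cyclotomic]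
    exact hζ.isRoot_cyclotomic (by positivity)
  have h1 := aeval_eq_zero_of_dvd_aeval_eq_zero h' h0
  rw [map_add, map_pow, aeval_X, map_one] at h1
  have h2 := hζ.dvd_of_pow_eq_one (2 * m) (by
    rw [mul_comm 2 m, pow_mul, eq_neg_of_add_eq_zero_left h1, neg_one_sq])
  have := Nat.le_of_dvd (by positivity) h2
  nlinarith [hp.two_le]

/-- Let `n` be a positive integer that is not a power of `2`.  For
`F ∈ ℤ[z]`, `Φ_{2n} ∣ F` if and only if `F` can be written as
`f₀·(z^n + 1) + Σ_p f_p·Φ_p(-z^{n/p})`, the sum running over the odd prime divisors of `n`. -/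
theorem cyclotomic_ideal_generators (n : ℕ) (hn : 0 < n) (h2 : ¬∃ k : ℕ, n = 2 ^ k)
    (F : Polynomial ℤ) :
    cyclotomic (2 * n) ℤ ∣ F ↔
      ∃ (f₀ : Polynomial ℤ) (f : ℕ → Polynomial ℤ),
        F = f₀ * (X ^ n + 1) +
          ∑ p ∈ n.primeFactors.filter (fun p => Odd p),
            f p * (cyclotomic p ℤ).comp (-(X ^ (n / p))) := by
  constructor
  · intro hF
    set g : ℕ → ℤ[X] := fun p => (cyclotomic p ℤ).comp (-(X ^ (n / p)))
    set s := n.primeFactors.filter (fun p => Odd p)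
    set J : Ideal ℤ[X] := Ideal.span {X ^ n + 1} ⊔ Ideal.span (g '' s)
    have hX : X ^ n + 1 ∈ J := Ideal.mem_sup_left (Ideal.mem_span_singleton_self _)
    have hle : primeCyclotomicIdeal (2 * n) ≤ J := by
      refine Ideal.span_le.2 ?_
      rintro _ (rfl | ⟨p, m, hp, hpm, rfl⟩)
      · rw [show (X ^ (2 * n) - 1 : ℤ[X]) = (X ^ n - 1) * (X ^ n + 1) by ring]
        exact J.mul_mem_left _ hX
      · rcases hp.eq_two_or_odd' with rfl | hodd
        · obtain rfl : n = m := by omega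
          simpa using hX
        · obtain ⟨k, rfl⟩ : 2 ∣ m := ((Nat.coprime_primes Nat.prime_two hp).2
            (by rintro rfl; exact absurd hodd (by decide))).dvd_of_dvd_mul_right
              (hpm ▸ dvd_mul_right 2 n)
          obtain rfl : n = k * p := by rw [mul_assoc] at hpm; omega
          refine J.mem_of_dvd (cyclotomic_prime_comp_neg_dvd_expand hp hodd k) ?_
          refine Ideal.mem_sup_right (Ideal.subset_span ⟨p, ?_, ?_⟩)
          · simp [s, hp, hodd, hn.ne']
          · simp [g, Nat.mul_div_cancel _ hp.pos]
    have hFJ : F ∈ J :=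
      J.mem_of_dvd hF (hle (cyclotomic_mem_primeCyclotomicIdeal (by positivity)))
    obtain ⟨a, ha, b, hb, rfl⟩ := Submodule.mem_sup.1 hFJ
    obtain ⟨f₀, rfl⟩ := Ideal.mem_span_singleton'.1 ha
    obtain ⟨f, rfl⟩ := (Submodule.mem_span_image_finset_iff_exists_fun' ℤ[X]).1 hb
    exact ⟨f₀, f, rfl⟩
  · rintro ⟨f₀, f, rfl⟩
    refine dvd_add ((cyclotomic_two_mul_dvd_X_pow_add_one hn).mul_left _)
      (Finset.dvd_sum fun p hp => Dvd.dvd.mul_left ?_ _)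
    simp only [Finset.mem_filter, Nat.mem_primeFactors] at hp
    obtain ⟨⟨hp, ⟨m, rfl⟩, -⟩, hodd⟩ := hp
    rw [Nat.mul_div_cancel_left _ hp.pos, mul_comm p m]
    exact cyclotomic_two_mul_dvd_cyclotomic_comp_neg hp hodd (Nat.pos_of_mul_pos_left hn)
end
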